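/- Let m ≥ 2 and let f : S^{m-1} → ℝ be a smooth function. If there exists a non-negative Legendrian isotopy {Λ_t}_{t∈[0,1]} in E = J¹(S^{m-1}) with Λ_0 the zero section Λ^0 and Λ_1 the 1-jet graph Λ^f, then f(q) ≥ 0 for every q ∈ S^{m-1}. -/

import Mathlib

/-!
STATEMENT 5: If a non-negative Legendrian isotopy in `E = J¹(S^{m-1})` connects the zero
section `Λ⁰` to the 1-jet graph `Λ^f` of a smooth function `f : S^{m-1} → ℝ`, then
`f ≥ 0` on `S^{m-1}` (Proposition 5.4 of the paper for `L = S^{m-1}`).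

We identify `J¹(S^{m-1})` with
`E = {(q,p,u) ∈ S^{m-1} × ℝ^m × ℝ : ⟨p,q⟩ = 0}`.
A Legendrian isotopy starting at the zero section is recorded by a map
`F : S^{m-1} × [0,1] → E`, `F(s,t) = (q(s,t), p(s,t), u(s,t))`, `F₀` the inclusion;
smoothness of `F` (a map defined on the submanifold `S^{m-1} × [0,1]`) is expressed,
equivalently, by smoothness of an ambient extension `F : ℝ^m × ℝ → ℝ^m × ℝ^m × ℝ`
(only the values on `S^{m-1} × [0,1]` are constrained; tangency conditions use only
vectors `v` tangent to the sphere, so they depend only on the restriction).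
Each `F_t` is an embedding (injective immersion of the compact sphere) onto a
Legendrian submanifold: tangent vectors `(w,v,a)` of `Λ_t` satisfy `a = ⟨p,w⟩`.
Non-negativity: `∂u/∂t - ⟨p, ∂q/∂t⟩ ≥ 0`.
Smooth functions on `S^{m-1}` are likewise represented by smooth ambient functions
`f : ℝ^m → ℝ`; the 1-jet graph uses the round-metric gradient, i.e. the tangential
part of the ambient gradient.
-/

noncomputable section

open Set Metric
open scoped RealInnerProductSpace

/-- The unit sphere `S^{m-1} ⊂ ℝ^m`. -/
def sph (m : ℕ) : Set (EuclideanSpace ℝ (Fin m)) := Metric.sphere (0 : EuclideanSpace ℝ (Fin m)) 1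

/-- Ambient model `ℝ^m × ℝ^m × ℝ` of the 1-jet space `J¹(S^{m-1})`. -/
abbrev JetSp (m : ℕ) := EuclideanSpace ℝ (Fin m) × EuclideanSpace ℝ (Fin m) × ℝ

/-- `F : ℝ^m × ℝ → ℝ^m × ℝ^m × ℝ` represents a Legendrian isotopy `{Λ_t}_{t∈[0,1]}` in
`E = J¹(S^{m-1})` parameterised by the sphere: it is smooth, maps `S^{m-1} × [0,1]` into
`E`, each `F_t|_{S^{m-1}}` is an injective immersion (hence an embedding of the compact
sphere) onto `Λ_t`, and each `Λ_t` is Legendrian: every tangent vector `(w,v,a)` of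
`Λ_t` satisfies `a = ⟨p,w⟩`. -/
structure IsLegIsotopyJet (m : ℕ) (F : EuclideanSpace ℝ (Fin m) × ℝ → JetSp m) : Prop where
  smooth : ContDiff ℝ (⊤ : ℕ∞) F
  mem_sphere : ∀ s ∈ sph m, ∀ t ∈ Icc (0:ℝ) 1, (F (s, t)).1 ∈ sph m
  mem_jet : ∀ s ∈ sph m, ∀ t ∈ Icc (0:ℝ) 1, ⟪(F (s, t)).2.1, (F (s, t)).1⟫ = 0
  inj : ∀ t ∈ Icc (0:ℝ) 1, InjOn (fun s => F (s, t)) (sph m)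
  imm : ∀ t ∈ Icc (0:ℝ) 1, ∀ s ∈ sph m, ∀ v : EuclideanSpace ℝ (Fin m),
    ⟪v, s⟫ = 0 → v ≠ 0 → fderiv ℝ (fun s' => F (s', t)) s v ≠ 0
  leg : ∀ t ∈ Icc (0:ℝ) 1, ∀ s ∈ sph m, ∀ v : EuclideanSpace ℝ (Fin m), ⟪v, s⟫ = 0 →
    (fderiv ℝ (fun s' => F (s', t)) s v).2.2
      = ⟪(F (s, t)).2.1, (fderiv ℝ (fun s' => F (s', t)) s v).1⟫

/-- Non-negativity of the Legendrian isotopy: `∂u/∂t - ⟨p, ∂q/∂t⟩ ≥ 0`. -/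
def NonnegJet (m : ℕ) (F : EuclideanSpace ℝ (Fin m) × ℝ → JetSp m) : Prop :=
  ∀ s ∈ sph m, ∀ t ∈ Icc (0:ℝ) 1,
    0 ≤ deriv (fun t' => (F (s, t')).2.2) t
        - ⟪(F (s, t)).2.1, deriv (fun t' => (F (s, t')).1) t⟫

/-- The gradient of `f` along the sphere (round metric): tangential part of the ambient
gradient; it depends only on `f|_{S^{m-1}}`. -/
def sphGrad (m : ℕ) (f : EuclideanSpace ℝ (Fin m) → ℝ) (q : EuclideanSpace ℝ (Fin m)) :
    EuclideanSpace ℝ (Fin m) :=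
  gradient f q - ⟪gradient f q, q⟫ • q

/-- The 1-jet graph `Λ^f = {(q, ∇f(q), f(q)) : q ∈ S^{m-1}} ⊂ E`. -/
def jetGraph (m : ℕ) (f : EuclideanSpace ℝ (Fin m) → ℝ) : Set (JetSp m) :=
  (fun q => (q, sphGrad m f q, f q)) '' sph m

/-- The slice `Λ_t = F_t(S^{m-1})` of the isotopy. -/
def jetSlice (m : ℕ) (F : EuclideanSpace ℝ (Fin m) × ℝ → JetSp m) (t : ℝ) : Set (JetSp m) :=
  (fun s => F (s, t)) '' sph m

section Brouwer

open MeasureTheory Polynomial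

variable {V : Type*} [NormedAddCommGroup V] [InnerProductSpace ℝ V] [FiniteDimensional ℝ V]

lemma exists_polynomial_det_id_add_smul (A : V →L[ℝ] V) :
    ∃ p : ℝ[X], p.natDegree ≤ Module.finrank ℝ V ∧
      ∀ t : ℝ, p.eval t = (ContinuousLinearMap.id ℝ V + t • A).det := by
  classical
  let b := Module.finBasis ℝ V
  let M := LinearMap.toMatrix b b (A : V →ₗ[ℝ] V)
  refine ⟨Matrix.det ((X : ℝ[X]) • M.map C + (1 : Matrix _ _ ℝ).map C), ?_, fun t => ?_⟩
  · simpa using Polynomial.natDegree_det_X_add_C_le M 1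
  · have h1 : (ContinuousLinearMap.id ℝ V + t • A).det
        = LinearMap.det (LinearMap.id + t • (A : V →ₗ[ℝ] V)) := rfl
    rw [h1, ← LinearMap.det_toMatrix b, ← coe_evalRingHom, RingHom.map_det]
    congr 1
    ext i j
    simp [M, Matrix.one_apply]
    split_ifs <;> simp <;> ring

lemma det_fderiv_eq_zero_of_norm_eq {G : V → V} {R : ℝ} (hR : 0 < R) (hG : Differentiable ℝ G)
    (hn : ∀ v, ‖G v‖ = R) (v : V) : (fderiv ℝ G v).det = 0 := by
  by_contra hdet
  have hsurj : Function.Surjective (fderiv ℝ G v) :=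
    (LinearMap.equivOfDetNeZero (fderiv ℝ G v : V →ₗ[ℝ] V) hdet).surjective
  obtain ⟨w, hw⟩ := hsurj (G v)
  have h1 : HasFDerivAt (fun x => ⟪G x, G x⟫) _ v :=
    (hG v).hasFDerivAt.inner ℝ (hG v).hasFDerivAt
  have h2 : (fun x => ⟪G x, G x⟫) = fun _ => R ^ 2 := by
    ext x; rw [real_inner_self_eq_norm_sq, hn]
  rw [h2] at h1
  have h3 := congrArg (fun l => l w) (h1.unique (hasFDerivAt_const (R ^ 2) v))
  simp [hw, hn] at h3
  exact hR.ne' h3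

lemma integrableOn_det_ball {G : V → V} [MeasurableSpace V] [BorelSpace V]
    (hG : ContDiff ℝ 1 G) (R t : ℝ) :
    IntegrableOn (fun v => (ContinuousLinearMap.id ℝ V
      + t • (fderiv ℝ G v - ContinuousLinearMap.id ℝ V)).det) (ball 0 R) (volume : Measure V) := by
  have hc : Continuous (fun v => (ContinuousLinearMap.id ℝ V
      + t • (fderiv ℝ G v - ContinuousLinearMap.id ℝ V)).det) := by
    refine ContinuousLinearMap.continuous_det.comp ?_
    have := hG.continuous_fderiv one_ne_zero
    fun_prop
  exact (hc.continuousOn.integrableOn_compact (isCompact_closedBall 0 R)).mono_set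
    ball_subset_closedBall

/-- The volume of a ball is the integral of the Jacobian of a map close to the identity
preserving the ball. -/
lemma integral_det_eq_volume_ball {G : V → V} [MeasurableSpace V] [BorelSpace V] {R : ℝ}
    {L : NNReal} (hG : ContDiff ℝ 1 G) (hL : LipschitzWith L G)
    (hn : ∀ v, ‖G v‖ = R) (hout : ∀ v, R ≤ ‖v‖ → G v = (R / ‖v‖) • v) :
    ∃ t₀ : ℝ, 0 < t₀ ∧ ∀ t, 0 < t → t < t₀ →
      ∫ v in ball (0 : V) R, (ContinuousLinearMap.id ℝ V
        + t • (fderiv ℝ G v - ContinuousLinearMap.id ℝ V)).det = volume.real (ball (0 : V) R) := by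
  have hdet1 : ∀ᶠ A : V →L[ℝ] V in nhds (ContinuousLinearMap.id ℝ V), 0 < A.det := by
    refine ContinuousLinearMap.continuous_det.continuousAt.eventually (lt_mem_nhds ?_)
    simp [ContinuousLinearMap.det]
  obtain ⟨δ, hδ, hpos⟩ := Metric.eventually_nhds_iff.1 hdet1
  have hL1 : (0 : ℝ) < L + 1 := by positivity
  refine ⟨min (min 1 (δ / (L + 1))) (1 / (L + 1)) , by positivity, fun t ht ht0 => ?_⟩
  have ht1 : t < 1 := ht0.trans_le ((min_le_left _ _).trans (min_le_left _ _))
  have htδ : t * (L + 1) < δ :=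
    (lt_div_iff₀ hL1).1 (ht0.trans_le ((min_le_left _ _).trans (min_le_right _ _)))
  have htL : t * (L + 1) < 1 := (lt_div_iff₀ hL1).1 (ht0.trans_le (min_le_right _ _))
  set F : V → V := fun v => v + t • (G v - v) with hF
  have hF' : ∀ v, HasFDerivAt F (ContinuousLinearMap.id ℝ V
      + t • (fderiv ℝ G v - ContinuousLinearMap.id ℝ V)) v := fun v =>
    (hasFDerivAt_id v).add ((((hG.differentiable one_ne_zero) v).hasFDerivAt.sub
      (hasFDerivAt_id v)).const_smul t)
  have happ : ApproximatesLinearOn F ((ContinuousLinearEquiv.refl ℝ V : V ≃L[ℝ] V) : V →L[ℝ] V)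
      univ (Real.toNNReal t * (L + 1)) := by
    rw [ApproximatesLinearOn.approximatesLinearOn_iff_lipschitzOnWith]
    have h1 : (F - ⇑((ContinuousLinearEquiv.refl ℝ V : V ≃L[ℝ] V) : V →L[ℝ] V))
        = fun v => t • (G v - v) := by
      ext v; simp [hF]
    rw [h1]
    refine LipschitzWith.lipschitzOnWith ?_
    refine LipschitzWith.of_dist_le_mul fun v w => ?_
    rw [dist_eq_norm, ← smul_sub, norm_smul, Real.norm_of_nonneg ht.le]
    have h2 : G v - v - (G w - w) = (G v - G w) - (v - w) := by abel
    have h3 := hL.dist_le_mul v w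
    rw [dist_eq_norm, dist_eq_norm] at h3
    have h4 := norm_sub_le (G v - G w) (v - w)
    rw [h2, dist_eq_norm]
    push_cast
    rw [Real.coe_toNNReal _ ht.le]
    nlinarith [norm_nonneg (v - w)]
  have hc : Subsingleton V ∨ Real.toNNReal t * (L + 1) <
      ‖((ContinuousLinearEquiv.refl ℝ V).symm : V →L[ℝ] V)‖₊⁻¹ := by
    rcases subsingleton_or_nontrivial V with h | h
    · exact Or.inl h
    · right
      have h1 : ‖((ContinuousLinearEquiv.refl ℝ V).symm : V →L[ℝ] V)‖₊ = 1 := by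
        have : ((ContinuousLinearEquiv.refl ℝ V).symm : V →L[ℝ] V)
          = ContinuousLinearMap.id ℝ V := rfl
        rw [this]
        exact ContinuousLinearMap.nnnorm_id
      rw [h1, inv_one, ← NNReal.coe_lt_coe]
      push_cast
      rwa [Real.coe_toNNReal _ ht.le]
  have hsurj : Function.Surjective F := happ.surjective hc
  have hinj : InjOn F (ball 0 R) := (happ.injOn hc).mono (subset_univ _)
  have himg : F '' ball 0 R = ball 0 R := by
    have hF2 : ∀ v, F v = (1 - t) • v + t • G v := fun v => by simp only [hF]; module
    apply Subset.antisymm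
    · rintro _ ⟨v, hv, rfl⟩
      rw [mem_ball_zero_iff] at hv ⊢
      rw [hF2]
      refine (norm_add_le _ _).trans_lt ?_
      rw [norm_smul, norm_smul, hn, Real.norm_of_nonneg ht.le, Real.norm_of_nonneg (by linarith)]
      nlinarith
    · intro w hw
      obtain ⟨v, rfl⟩ := hsurj w
      refine ⟨v, ?_, rfl⟩
      rw [mem_ball_zero_iff] at hw ⊢
      by_contra hv
      push Not at hv
      rw [hF2, hout v hv, smul_smul, ← add_smul, norm_smul] at hw
      have hR : 0 ≤ R := by rw [← hn v]; positivity
      rcases hR.eq_or_lt with hR0 | hR0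
      · rw [← hR0] at hw
        exact absurd hw (not_lt.2 (by positivity))
      have hv0 : 0 < ‖v‖ := hR0.trans_le hv
      rw [Real.norm_of_nonneg (by
        have : 0 ≤ t * (R / ‖v‖) := by positivity
        linarith)] at hw
      have : (1 - t + t * (R / ‖v‖)) * ‖v‖ = (1 - t) * ‖v‖ + t * R := by field_simp
      rw [this] at hw
      nlinarith
  have hpos' : ∀ v, 0 < (ContinuousLinearMap.id ℝ V
      + t • (fderiv ℝ G v - ContinuousLinearMap.id ℝ V)).det := by
    intro v
    apply hpos
    rw [dist_eq_norm, add_sub_cancel_left, norm_smul, Real.norm_of_nonneg ht.le]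
    refine lt_of_le_of_lt ?_ htδ
    gcongr
    refine (norm_sub_le _ _).trans ?_
    gcongr
    · exact norm_fderiv_le_of_lipschitz ℝ hL
    · exact ContinuousLinearMap.norm_id_le
  have key := integral_image_eq_integral_abs_det_fderiv_smul (volume : Measure V)
    (measurableSet_ball (x := (0 : V)) (ε := R)) (fun v _ => (hF' v).hasFDerivWithinAt) hinj
    (fun _ => (1 : ℝ))
  rw [himg] at key
  simp only [smul_eq_mul, mul_one, integral_const, measureReal_restrict_apply_univ] at key
  rw [key]
  refine integral_congr_ae (Filter.Eventually.of_forall fun v => ?_)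
  exact (abs_of_pos (hpos' v)).symm

/-- There is no retraction of a ball onto its boundary sphere. -/
lemma no_retraction {G : V → V} {R : ℝ} (hR : 0 < R) {L : NNReal} (hG : ContDiff ℝ 1 G)
    (hL : LipschitzWith L G) (hn : ∀ v, ‖G v‖ = R)
    (hout : ∀ v, R ≤ ‖v‖ → G v = (R / ‖v‖) • v) : False := by
  let _ : MeasurableSpace V := borel V
  have _ : BorelSpace V := ⟨rfl⟩
  obtain ⟨t₀, ht₀, h_int⟩ := integral_det_eq_volume_ball hG hL hn hout
  set d := Module.finrank ℝ V
  let J : V → ℝ → ℝ := fun v t => (ContinuousLinearMap.id ℝ V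
      + t • (fderiv ℝ G v - ContinuousLinearMap.id ℝ V)).det
  let τ : ℕ → ℝ := fun i => t₀ / (i + 2)
  have hτ : InjOn τ (Finset.range (d + 1) : Set ℕ) := by
    intro i _ j _ hij
    have hi : (0 : ℝ) < (i : ℝ) + 2 := by positivity
    have hj : (0 : ℝ) < (j : ℝ) + 2 := by positivity
    simp only [τ] at hij
    rw [div_eq_div_iff hi.ne' hj.ne'] at hij
    have := mul_left_cancel₀ ht₀.ne' hij
    have h2 : (j : ℝ) = i := by linarith
    exact_mod_cast h2.symm
  let c : ℕ → ℝ := fun i => (Lagrange.basis (Finset.range (d + 1)) τ i).eval 1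
  have hJ : ∀ v, J v 1 = ∑ i ∈ Finset.range (d + 1), c i * J v (τ i) := by
    intro v
    obtain ⟨p, hp, hpe⟩ := exists_polynomial_det_id_add_smul
      (fderiv ℝ G v - ContinuousLinearMap.id ℝ V)
    have hdeg : p.degree < ((Finset.range (d + 1)).card : ℕ) := by
      rw [Finset.card_range]
      exact (Polynomial.degree_le_of_natDegree_le hp).trans_lt (by exact_mod_cast Nat.lt_succ_self d)
    have h1 := congrArg (Polynomial.eval 1) (Lagrange.eq_interpolate hτ hdeg)
    rw [Lagrange.interpolate_apply, Polynomial.eval_finsetSum, hpe] at h1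
    simp only [Polynomial.eval_mul, Polynomial.eval_C, hpe] at h1
    simp only [J, c, h1, mul_comm]
  have hsum : ∑ i ∈ Finset.range (d + 1), c i = 1 := by
    have := congrArg (Polynomial.eval (1 : ℝ))
      (Lagrange.sum_basis hτ ⟨0, Finset.mem_range.2 (Nat.succ_pos d)⟩)
    rwa [Polynomial.eval_finsetSum, Polynomial.eval_one] at this
  have h0 : ∀ v, J v 1 = 0 := by
    intro v
    have := det_fderiv_eq_zero_of_norm_eq hR (hG.differentiable one_ne_zero) hn v
    simpa [J] using this
  have h1 : ∫ v in ball (0 : V) R, J v 1 = volume.real (ball (0 : V) R) := by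
    simp_rw [hJ]
    rw [integral_finsetSum _ fun i _ => (integrableOn_det_ball hG R (τ i)).const_mul (c i)]
    have : ∀ i ∈ Finset.range (d + 1), ∫ v in ball (0 : V) R, c i * J v (τ i)
        = c i * volume.real (ball (0 : V) R) := by
      intro i _
      rw [integral_const_mul, h_int (τ i) (by positivity)]
      exact div_lt_self ht₀ (by linarith [(Nat.cast_nonneg i : (0 : ℝ) ≤ i)])
    rw [Finset.sum_congr rfl this, ← Finset.sum_mul, hsum, one_mul]
  simp only [h0, integral_zero] at h1
  have h2 : 0 < volume.real (ball (0 : V) R) :=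
    ENNReal.toReal_pos (measure_ball_pos _ _ hR).ne' measure_ball_lt_top.ne
  exact h2.ne h1

/-- A form of Brouwer's theorem: a bounded `C¹` perturbation of the identity has a zero. -/
theorem exists_add_eq_zero_of_bounded {b : V → V} (hb : ContDiff ℝ 1 b) {C : ℝ}
    (hC : ∀ v, ‖b v‖ ≤ C) : ∃ v, v + b v = 0 := by
  by_contra! hne
  have hC0 : 0 ≤ C := (norm_nonneg _).trans (hC 0)
  let χ : ContDiffBump (0 : V) := ⟨C + 1, C + 2, by linarith, by linarith⟩
  let B : V → V := fun v => χ v • b v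
  have hBc : ContDiff ℝ 1 B := χ.contDiff.smul hb
  have hBs : HasCompactSupport B := χ.hasCompactSupport.smul_right
  obtain ⟨L, hL⟩ := hBc.lipschitzWith_of_hasCompactSupport hBs one_ne_zero
  let g : V → V := fun v => v + B v
  have hgc : ContDiff ℝ 1 g := contDiff_id.add hBc
  have hBle : ∀ v, ‖B v‖ ≤ C := fun v => by
    simp only [B, norm_smul, Real.norm_of_nonneg χ.nonneg]
    calc χ v * ‖b v‖ ≤ 1 * C := mul_le_mul χ.le_one (hC v) (norm_nonneg _) zero_le_one
      _ = C := one_mul C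
  have hgne : ∀ v, g v ≠ 0 := by
    intro v hv
    have hv' : v = - B v := eq_neg_of_add_eq_zero_left hv
    have h1 : ‖v‖ ≤ C := by rw [hv', norm_neg]; exact hBle v
    have h2 : χ v = 1 := χ.one_of_mem_closedBall
      (by rw [mem_closedBall_zero_iff]; change ‖v‖ ≤ C + 1; linarith)
    apply hne v
    simpa [g, B, h2] using hv
  have hgout : ∀ v, C + 2 ≤ ‖v‖ → g v = v := by
    intro v hv
    have : χ v = 0 := χ.zero_of_le_dist (by rw [dist_zero_right]; exact hv)
    simp [g, B, this]
  obtain ⟨c, hc, hgc'⟩ : ∃ c > 0, ∀ v, c ≤ ‖g v‖ := by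
    obtain ⟨x, hx, hmin⟩ := (isCompact_closedBall (0 : V) (C + 2)).exists_isMinOn
      ⟨0, mem_closedBall_self (by linarith)⟩ hgc.continuous.norm.continuousOn
    refine ⟨min ‖g x‖ 1, lt_min (norm_pos_iff.2 (hgne x)) one_pos, fun v => ?_⟩
    rcases le_total ‖v‖ (C + 2) with hv | hv
    · exact (min_le_left _ _).trans (hmin (mem_closedBall_zero_iff.2 hv))
    · rw [hgout v hv]
      exact (min_le_right _ _).trans (by linarith)
  have hR : 0 < 2 * C + 3 := by linarith
  let G : V → V := fun v => ((2 * C + 3) / ‖g v‖) • g v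
  have hGc : ContDiff ℝ 1 G :=
    (contDiff_const.div (hgc.norm ℝ hgne) fun v => norm_ne_zero_iff.2 (hgne v)).smul hgc
  have hGn : ∀ v, ‖G v‖ = 2 * C + 3 := fun v => by
    have : 0 < ‖g v‖ := norm_pos_iff.2 (hgne v)
    simp only [G, norm_smul]
    rw [Real.norm_of_nonneg (by positivity)]
    field_simp
  have hgL : ∀ v w, ‖g v - g w‖ ≤ (1 + L) * ‖v - w‖ := by
    intro v w
    have h1 := hL.dist_le_mul v w
    rw [dist_eq_norm, dist_eq_norm] at h1
    have h2 : g v - g w = (v - w) + (B v - B w) := by simp only [g]; abel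
    rw [h2]
    linarith [norm_add_le (v - w) (B v - B w)]
  have hGL : LipschitzWith (Real.toNNReal (2 * (2 * C + 3) / c * (1 + L))) G := by
    refine LipschitzWith.of_dist_le_mul fun v w => ?_
    rw [Real.coe_toNNReal _ (by positivity), dist_eq_norm, dist_eq_norm]
    have hv : 0 < ‖g v‖ := norm_pos_iff.2 (hgne v)
    have hw : 0 < ‖g w‖ := norm_pos_iff.2 (hgne w)
    have h1 : G v - G w = ((2 * C + 3) / ‖g v‖) • ((g v - g w) +
        ((‖g w‖ - ‖g v‖) / ‖g w‖) • g w) := by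
      change ((2 * C + 3) / ‖g v‖) • g v - ((2 * C + 3) / ‖g w‖) • g w = _
      rw [smul_add _ (g v - g w), smul_sub _ (g v) (g w), smul_smul]
      have : (2 * C + 3) / ‖g v‖ * ((‖g w‖ - ‖g v‖) / ‖g w‖)
          = (2 * C + 3) / ‖g v‖ - (2 * C + 3) / ‖g w‖ := by field_simp
      rw [this]
      module
    have h2 : ‖((‖g w‖ - ‖g v‖) / ‖g w‖) • g w‖ ≤ ‖g v - g w‖ := by
      rw [norm_smul, norm_div, norm_norm, div_mul_cancel₀ _ hw.ne', Real.norm_eq_abs, abs_sub_comm]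
      exact abs_norm_sub_norm_le _ _
    calc ‖G v - G w‖ = (2 * C + 3) / ‖g v‖ * ‖(g v - g w) +
          ((‖g w‖ - ‖g v‖) / ‖g w‖) • g w‖ := by
          rw [h1, norm_smul, Real.norm_of_nonneg (by positivity)]
      _ ≤ (2 * C + 3) / c * (2 * ‖g v - g w‖) := by
          gcongr
          · exact hgc' v
          · linarith [norm_add_le (g v - g w) (((‖g w‖ - ‖g v‖) / ‖g w‖) • g w)]
      _ ≤ (2 * C + 3) / c * (2 * ((1 + L) * ‖v - w‖)) := by gcongr; exact hgL v w
      _ = 2 * (2 * C + 3) / c * (1 + L) * ‖v - w‖ := by ring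
  refine no_retraction hR hGc hGL hGn fun v hv => ?_
  simp only [G, hgout v (by linarith)]

end Brouwer

section Saddle

variable {E V : Type*} [NormedAddCommGroup E] [InnerProductSpace ℝ E]
  [NormedAddCommGroup V] [InnerProductSpace ℝ V] [FiniteDimensional ℝ V]

/-- A gradient step with small step size decreases a function with Lipschitz gradient. -/
lemma gradient_step_le {A : E → ℝ} {G : E → E} {L : NNReal}
    (hA : ∀ z, HasFDerivAt A (innerSL ℝ (G z)) z) (hL : LipschitzWith L G) {τ : ℝ} (hτ : 0 < τ)
    (hτL : L * τ ≤ 1 / 2) (z : E) : A (z - τ • G z) ≤ A z - τ / 2 * ‖G z‖ ^ 2 := by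
  set w : E := -(τ • G z)
  have hφ : ∀ s : ℝ, HasDerivAt (fun s : ℝ => A (z + s • w)) ⟪G (z + s • w), w⟫ s := by
    intro s
    have h1 : HasDerivAt (fun s : ℝ => z + s • w) w s := by
      simpa using ((hasDerivAt_id s).smul_const w).const_add z
    exact (hA (z + s • w)).comp_hasDerivAt s h1
  obtain ⟨s, hs, hs'⟩ := exists_hasDerivAt_eq_slope (fun s : ℝ => A (z + s • w)) _ zero_lt_one
    (continuous_iff_continuousAt.2 fun s => (hφ s).continuousAt).continuousOn (fun s _ => hφ s)
  have h1 : z + w = z - τ • G z := by simp [w, sub_eq_add_neg]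
  simp only [one_smul, zero_smul, add_zero, sub_zero, div_one, h1] at hs'
  have h2 : ⟪G (z + s • w), w⟫ = ⟪G z, w⟫ + ⟪G (z + s • w) - G z, w⟫ := by
    rw [inner_sub_left]; ring
  have h3 : ⟪G z, w⟫ = - τ * ‖G z‖ ^ 2 := by
    simp only [w, inner_neg_right, inner_smul_right, real_inner_self_eq_norm_sq]; ring
  have h4 : ‖w‖ = τ * ‖G z‖ := by rw [norm_neg, norm_smul, Real.norm_of_nonneg hτ.le]
  have h5 : ‖G (z + s • w) - G z‖ ≤ L * (τ * ‖G z‖) := by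
    have := hL.dist_le_mul (z + s • w) z
    rw [dist_eq_norm, dist_eq_norm, add_sub_cancel_left, norm_smul, Real.norm_of_nonneg hs.1.le,
      h4] at this
    refine this.trans ?_
    exact mul_le_mul_of_nonneg_left (mul_le_of_le_one_left (by positivity) hs.2.le) L.2
  have h6 : ⟪G (z + s • w) - G z, w⟫ ≤ L * (τ * ‖G z‖) * (τ * ‖G z‖) :=
    (real_inner_le_norm _ _).trans (by rw [h4]; gcongr)
  have h7 : L * (τ * ‖G z‖) * (τ * ‖G z‖) ≤ 1 / 2 * (τ * ‖G z‖ ^ 2) := by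
    have : L * (τ * ‖G z‖) * (τ * ‖G z‖) = (L * τ) * (τ * ‖G z‖ ^ 2) := by ring
    rw [this]
    gcongr
  nlinarith

/-- Linking argument: almost critical points above the level `c`, for a function whose gradient
is a bounded perturbation of a linear map `J` acting as `-1` modulo `ker π`, bounded above on a
complement of `ker π` and bounded below by `c` on `ker π`. -/
theorem exists_almost_critical_of_linking {A : E → ℝ} {G : E → E} {L : NNReal}
    (hA : ∀ z, HasFDerivAt A (innerSL ℝ (G z)) z) (hG : ContDiff ℝ 1 G) (hL : LipschitzWith L G)
    {J : E → E} {C : ℝ} (hJ : ∀ z, ‖G z - J z‖ ≤ C) (π : E →L[ℝ] V) (ι : V →L[ℝ] E)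
    (hπJ : ∀ z, π (J z) = - π z) (hπι : ∀ v, π (ι v) = v) {M c : ℝ} (hM : ∀ v, A (ι v) ≤ M)
    (hc : ∀ z, π z = 0 → c ≤ A z) {δ : ℝ} (hδ : 0 < δ) : ∃ z, c ≤ A z ∧ ‖G z‖ ≤ δ := by
  by_contra! hcon
  set τ : ℝ := 1 / (2 * (L + 1)) with hτdef
  have hL1 : (0 : ℝ) < L + 1 := by positivity
  have hτ : 0 < τ := by positivity
  have hτL : L * τ ≤ 1 / 2 := by
    rw [hτdef, mul_one_div, div_le_div_iff₀ (by positivity) (by positivity)]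
    linarith
  set T : E → E := fun z => z - τ • G z with hT
  have hstep : ∀ z, A (T z) ≤ A z - τ / 2 * ‖G z‖ ^ 2 := gradient_step_le hA hL hτ hτL
  have hdesc : ∀ (n : ℕ) z, A z ≤ M → A (T^[n] z) < c ∨ A (T^[n] z) ≤ M - n * (τ / 2 * δ ^ 2) := by
    intro n z hz
    induction n with
    | zero => right; simpa using hz
    | succ n ih =>
      rw [Function.iterate_succ_apply']
      have h1 := hstep (T^[n] z)
      by_cases h2 : c ≤ A (T^[n] z)
      · right
        have h3 := ih.resolve_left (not_lt.2 h2)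
        have h4 : δ ^ 2 ≤ ‖G (T^[n] z)‖ ^ 2 := by gcongr; exact (hcon _ h2).le
        have h5 : τ / 2 * δ ^ 2 ≤ τ / 2 * ‖G (T^[n] z)‖ ^ 2 := by gcongr
        push_cast
        linarith
      · left
        have : 0 ≤ τ / 2 * ‖G (T^[n] z)‖ ^ 2 := by positivity
        linarith
  obtain ⟨n, hn⟩ := exists_nat_gt ((M - c) / (τ / 2 * δ ^ 2))
  rw [div_lt_iff₀ (by positivity)] at hn
  have hpert : ∀ n : ℕ, ∃ B, ∀ z, ‖π (T^[n] z) - (1 + τ) ^ n • π z‖ ≤ B := by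
    intro n
    induction n with
    | zero => exact ⟨0, fun z => by simp⟩
    | succ n ih =>
      obtain ⟨B, hB⟩ := ih
      refine ⟨(1 + τ) * B + τ * (‖π‖ * C), fun z => ?_⟩
      rw [Function.iterate_succ_apply']
      set y := T^[n] z
      have h1 : π (T y) - (1 + τ) ^ (n + 1) • π z
          = (1 + τ) • (π y - (1 + τ) ^ n • π z) - τ • π (G y - J y) := by
        simp only [hT, map_sub, map_smul, hπJ, pow_succ]
        module
      rw [h1]
      refine (norm_sub_le _ _).trans ?_
      rw [norm_smul, norm_smul, Real.norm_of_nonneg hτ.le, Real.norm_of_nonneg (by positivity)]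
      gcongr
      · exact hB z
      · exact (π.le_opNorm _).trans (by gcongr; exact hJ y)
  obtain ⟨B, hB⟩ := hpert n
  have hTn : ContDiff ℝ 1 T^[n] := by
    have hT1 : ContDiff ℝ 1 T := contDiff_id.sub (contDiff_const.smul hG)
    clear hB hn
    induction n with
    | zero => exact contDiff_id
    | succ n ih => rw [Function.iterate_succ']; exact hT1.comp ih
  have hpos : 0 < (1 + τ) ^ n := by positivity
  let b : V → V := fun v => ((1 + τ) ^ n)⁻¹ • (π (T^[n] (ι v)) - (1 + τ) ^ n • v)
  have hb : ContDiff ℝ 1 b :=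
    contDiff_const.smul ((π.contDiff.comp (hTn.comp ι.contDiff)).sub
      (contDiff_const.smul contDiff_id))
  have hbC : ∀ v, ‖b v‖ ≤ ((1 + τ) ^ n)⁻¹ * B := fun v => by
    simp only [b]
    rw [norm_smul, Real.norm_of_nonneg (by positivity)]
    gcongr
    simpa [hπι] using hB (ι v)
  obtain ⟨v, hv⟩ := exists_add_eq_zero_of_bounded hb hbC
  have hv0 : π (T^[n] (ι v)) = 0 := by
    simp only [b] at hv
    rw [smul_sub, smul_smul, inv_mul_cancel₀ hpos.ne', one_smul, add_sub_cancel] at hv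
    exact (smul_eq_zero.1 hv).resolve_left (inv_ne_zero hpos.ne')
  have h1 := hc _ hv0
  rcases hdesc n (ι v) (hM v) with h2 | h2 <;> linarith

end Saddle

section Discrete

lemma sum_comp_affine {E W ι : Type*} [NormedAddCommGroup E] [NormedSpace ℝ E]
    [NormedAddCommGroup W] [NormedSpace ℝ W] [Fintype ι] {k : ι → W → ℝ}
    (hk : ∀ i, ContDiff ℝ 2 (k i)) (hs : ∀ i, HasCompactSupport (k i)) (ℓ : ι → E →L[ℝ] W)
    (a : ι → W) :
    (∀ z, HasFDerivAt (fun z => ∑ i, k i (ℓ i z + a i))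
      (∑ i, (fderiv ℝ (k i) (ℓ i z + a i)).comp (ℓ i)) z) ∧
    ContDiff ℝ 1 (fun z => ∑ i, (fderiv ℝ (k i) (ℓ i z + a i)).comp (ℓ i)) ∧
    (∃ L : NNReal, LipschitzWith L fun z => ∑ i, (fderiv ℝ (k i) (ℓ i z + a i)).comp (ℓ i)) ∧
    (∃ C : ℝ, ∀ z, ‖∑ i, (fderiv ℝ (k i) (ℓ i z + a i)).comp (ℓ i)‖ ≤ C) ∧
    ∃ M : ℝ, ∀ z, ∑ i, k i (ℓ i z + a i) ≤ M := by
  have hf : ∀ i, ContDiff ℝ 1 (fderiv ℝ (k i)) := fun i => (hk i).fderiv_right (by norm_num)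
  refine ⟨fun z => ?_, ?_, ?_, ?_, ?_⟩
  · refine HasFDerivAt.fun_sum fun i _ => ?_
    have h1 : HasFDerivAt (k i) (fderiv ℝ (k i) (ℓ i z + a i)) (ℓ i z + a i) :=
      ((hk i).differentiable (by norm_num) _).hasFDerivAt
    exact h1.comp z ((ℓ i).hasFDerivAt.add_const (a i))
  · refine ContDiff.sum fun i _ => ?_
    exact ((hf i).comp ((ℓ i).contDiff.add contDiff_const)).clm_comp contDiff_const
  · choose L hL using fun i =>
      (hf i).lipschitzWith_of_hasCompactSupport ((hs i).fderiv ℝ) (by norm_num)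
    refine ⟨∑ i, L i * ‖ℓ i‖₊ * ‖ℓ i‖₊, LipschitzWith.of_dist_le_mul fun z w => ?_⟩
    rw [dist_eq_norm, dist_eq_norm, ← Finset.sum_sub_distrib]
    push_cast
    rw [Finset.sum_mul]
    refine (norm_sum_le _ _).trans (Finset.sum_le_sum fun i _ => ?_)
    rw [← ContinuousLinearMap.sub_comp]
    refine (ContinuousLinearMap.opNorm_comp_le _ _).trans ?_
    have h1 := (hL i).dist_le_mul (ℓ i z + a i) (ℓ i w + a i)
    rw [dist_eq_norm, dist_eq_norm, add_sub_add_right_eq_sub, ← map_sub] at h1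
    calc _ ≤ (L i * (‖ℓ i‖ * ‖z - w‖)) * ‖ℓ i‖ := by
          gcongr
          exact h1.trans (by gcongr; exact (ℓ i).le_opNorm _)
      _ = _ := by ring
  · choose C hC using fun i =>
      ((hs i).fderiv ℝ).exists_bound_of_continuous (hf i).continuous
    refine ⟨∑ i, C i * ‖ℓ i‖, fun z => (norm_sum_le _ _).trans (Finset.sum_le_sum fun i _ => ?_)⟩
    refine (ContinuousLinearMap.opNorm_comp_le _ _).trans ?_
    gcongr
    exact hC i _
  · choose C hC using fun i => (hs i).exists_bound_of_continuous (hk i).continuous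
    exact ⟨∑ i, C i, fun z => Finset.sum_le_sum fun i _ => (le_abs_self _).trans (hC i _)⟩

/-- A variant of `exists_almost_critical_of_linking` for a functional whose gradient is a linear
map plus a bounded Lipschitz perturbation. -/
lemma exists_almost_critical_of_linking_add {E V : Type*} [NormedAddCommGroup E]
    [InnerProductSpace ℝ E] [CompleteSpace E] [NormedAddCommGroup V] [InnerProductSpace ℝ V]
    [FiniteDimensional ℝ V] {A : E → ℝ} {J : E →L[ℝ] E} {P' : E → E →L[ℝ] ℝ} {L : NNReal} {C : ℝ}
    (hA : ∀ z, HasFDerivAt A (innerSL ℝ (J z) + P' z) z) (hP : ContDiff ℝ 1 P')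
    (hL : LipschitzWith L P') (hC : ∀ z, ‖P' z‖ ≤ C) (π : E →L[ℝ] V) (ι : V →L[ℝ] E)
    (hπJ : ∀ z, π (J z) = - π z) (hπι : ∀ v, π (ι v) = v) {M c : ℝ} (hM : ∀ v, A (ι v) ≤ M)
    (hc : ∀ z, π z = 0 → c ≤ A z) {δ : ℝ} (hδ : 0 < δ) :
    ∃ z, c ≤ A z ∧ ∀ e, |⟪J z, e⟫ + P' z e| ≤ δ * ‖e‖ := by
  let D := (InnerProductSpace.toDual ℝ E).symm
  let Dl : (E →L[ℝ] ℝ) →L[ℝ] E := LinearMap.mkContinuous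
      { toFun := fun l => D l, map_add' := fun _ _ => map_add D _ _,
        map_smul' := fun c l => by simp } 1 fun l => by simp
  have hDi : ∀ l v, ⟪Dl l, v⟫ = l v := fun l v => InnerProductSpace.toDual_symm_apply
  have hDn : ∀ l, ‖Dl l‖ = ‖l‖ := fun l => D.norm_map l
  obtain ⟨z, hz, hz2⟩ := exists_almost_critical_of_linking (A := A)
    (G := fun z => J z + Dl (P' z)) (J := J) (C := C) (L := ‖J‖₊ + ‖Dl‖₊ * L)
    (fun z => (hA z).congr_fderiv (by
      ext v
      change _ = ⟪J z + Dl (P' z), v⟫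
      rw [inner_add_left, hDi]
      rfl))
    (J.contDiff.add (Dl.contDiff.comp hP)) (J.lipschitz.add (Dl.lipschitz.comp hL))
    (fun z => by rw [add_sub_cancel_left, hDn]; exact hC z) π ι hπJ hπι hM hc hδ
  refine ⟨z, hz, fun e => ?_⟩
  rw [← hDi, ← inner_add_left]
  exact (abs_real_inner_le_norm _ e).trans (by gcongr)

/-- A hyperbolic quadratic form perturbed by a bounded-below compactly supported potential has
almost critical points of non-negative value. -/
lemma exists_almost_critical_pairing {H W ι : Type*} [NormedAddCommGroup H]
    [InnerProductSpace ℝ H] [FiniteDimensional ℝ H] [NormedAddCommGroup W] [NormedSpace ℝ W]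
    [Fintype ι] {k : ι → W → ℝ} (hk : ∀ i, ContDiff ℝ 2 (k i))
    (hs : ∀ i, HasCompactSupport (k i)) (h0 : ∀ i w, 0 ≤ k i w)
    (ℓ : ι → WithLp 2 (H × H) →L[ℝ] W) (a : ι → W) {δ : ℝ} (hδ : 0 < δ) :
    ∃ z : WithLp 2 (H × H), 0 ≤ ⟪z.fst, z.snd⟫ + ∑ i, k i (ℓ i z + a i) ∧
      ∀ e, |⟪z.fst, e.snd⟫ + ⟪e.fst, z.snd⟫ + ∑ i, fderiv ℝ (k i) (ℓ i z + a i) (ℓ i e)|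
        ≤ δ * ‖e‖ := by
  obtain ⟨hd, hc1, ⟨L, hL⟩, ⟨C, hC⟩, ⟨M, hM⟩⟩ := sum_comp_affine hk hs ℓ a
  set P' := fun z => ∑ i, (fderiv ℝ (k i) (ℓ i z + a i)).comp (ℓ i) with hP'
  let e := WithLp.prodContinuousLinearEquiv 2 ℝ H H
  let J : WithLp 2 (H × H) →L[ℝ] WithLp 2 (H × H) :=
    (e.symm : H × H →L[ℝ] WithLp 2 (H × H)).comp
      ((WithLp.sndL 2 ℝ H H).prod (WithLp.fstL 2 ℝ H H))
  have hJf : ∀ z, (J z).fst = z.snd := fun z => rfl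
  have hJs : ∀ z, (J z).snd = z.fst := fun z => rfl
  let π : WithLp 2 (H × H) →L[ℝ] H := (1 / 2 : ℝ) • (WithLp.fstL 2 ℝ H H - WithLp.sndL 2 ℝ H H)
  have hπ : ∀ z, π z = (1 / 2 : ℝ) • (z.fst - z.snd) := fun z => rfl
  let ι' : H →L[ℝ] WithLp 2 (H × H) :=
    (e.symm : H × H →L[ℝ] WithLp 2 (H × H)).comp
      ((ContinuousLinearMap.id ℝ H).prod (-ContinuousLinearMap.id ℝ H))
  have hιf : ∀ v, (ι' v).fst = v := fun z => rfl
  have hιs : ∀ v, (ι' v).snd = -v := fun z => rfl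
  have hA : ∀ z, HasFDerivAt (fun z : WithLp 2 (H × H) => ⟪z.fst, z.snd⟫ +
      ∑ i, k i (ℓ i z + a i)) (innerSL ℝ (J z) + P' z) z := by
    intro z
    have h1 : HasFDerivAt (fun z : WithLp 2 (H × H) => ⟪z.fst, z.snd⟫) _ z :=
      (WithLp.fstL 2 ℝ H H).hasFDerivAt.inner ℝ (WithLp.sndL 2 ℝ H H).hasFDerivAt
    refine (h1.add (hd z)).congr_fderiv ?_
    ext v
    have h4 : innerSL ℝ (J z) v = ⟪z.snd, v.fst⟫ + ⟪z.fst, v.snd⟫ := rfl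
    have h5 : (fderivInnerCLM ℝ ((WithLp.fstL 2 ℝ H H) z, z.snd) ∘SL
        (WithLp.fstL 2 ℝ H H).prod (WithLp.sndL 2 ℝ H H)) v
          = ⟪z.fst, v.snd⟫ + ⟪v.fst, z.snd⟫ := rfl
    rw [add_apply, add_apply, h4]
    erw [h5]
    rw [real_inner_comm v.fst z.snd, add_comm ⟪z.fst, v.snd⟫]
  have key := exists_almost_critical_of_linking_add
    (M := M) (c := 0) hA hc1 hL hC π ι' ?_ ?_ ?_ ?_ hδ
  · obtain ⟨z, hz, hz2⟩ := key
    refine ⟨z, hz, fun e => ?_⟩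
    have h1 := hz2 e
    have h2 : P' z e = ∑ i, fderiv ℝ (k i) (ℓ i z + a i) (ℓ i e) := by
      simp [hP']
    have h4 : ⟪J z, e⟫ = ⟪z.snd, e.fst⟫ + ⟪z.fst, e.snd⟫ := rfl
    rw [h2, h4] at h1
    rwa [add_comm ⟪z.fst, e.snd⟫, real_inner_comm z.snd e.fst]
  · intro z
    rw [hπ, hπ, hJf, hJs, ← smul_neg, neg_sub]
  · intro v
    rw [hπ, hιf, hιs, sub_neg_eq_add, ← two_smul ℝ, smul_smul]
    norm_num
  · intro v
    rw [hιf, hιs, inner_neg_right]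
    have := hM (ι' v)
    have h3 : 0 ≤ ⟪v, v⟫ := real_inner_self_nonneg
    linarith
  · intro z hz
    have h1 : z.fst = z.snd := by
      rw [hπ] at hz
      simpa [sub_eq_zero] using hz
    rw [h1]
    exact add_nonneg real_inner_self_nonneg (Finset.sum_nonneg fun i _ => h0 i _)

variable {V : Type*} [NormedAddCommGroup V] [InnerProductSpace ℝ V] [FiniteDimensional ℝ V]

/-- Discretised Hamiltonian boundary value problem: approximate discrete trajectories starting on
the fibre over `0`, ending with prescribed momentum `y₁`, and of non-negative action. -/
theorem exists_discrete_trajectory {N : ℕ} (hN : 0 < N) {k : ℕ → V × V → ℝ}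
    (hk : ∀ i, ContDiff ℝ 2 (k i)) (hs : ∀ i, HasCompactSupport (k i)) (h0 : ∀ i w, 0 ≤ k i w)
    (y₁ : V) {δ : ℝ} (hδ : 0 < δ) :
    ∃ x y : ℕ → V, y N = y₁ ∧ ‖x 0‖ ≤ δ ∧
      (∀ i < N, ∀ ξ, |⟪y (i + 1) - y i, ξ⟫ + fderiv ℝ (k i) (x i, y (i + 1)) (ξ, 0)| ≤ δ * ‖ξ‖) ∧
      (∀ i < N, ∀ ξ, |⟪x (i + 1) - x i, ξ⟫ - fderiv ℝ (k i) (x i, y (i + 1)) (0, ξ)|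
        ≤ 2 * δ * ‖ξ‖) ∧
      0 ≤ ∑ i ∈ Finset.range N, (⟪x i, y (i + 1) - y i⟫ + k i (x i, y (i + 1))) := by
  let H := PiLp 2 (fun _ : Fin N => V)
  let S : ℕ → WithLp 2 (H × H) →L[ℝ] V := fun n => ∑ j : Fin N,
    if n ≤ j then (PiLp.proj 2 (fun _ : Fin N => V) j).comp (WithLp.sndL 2 ℝ H H) else 0
  have hS : ∀ n z, S n z = ∑ j : Fin N, if n ≤ j then z.snd j else 0 := by
    intro n z
    simp only [S, sum_apply]
    refine Finset.sum_congr rfl fun j _ => ?_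
    split_ifs <;> rfl
  have hSsucc : ∀ (i : Fin N) z, S i z = z.snd i + S (i + 1) z := by
    intro i z
    have h1 : z.snd i = ∑ j : Fin N, if j = i then z.snd j else 0 := by simp
    rw [hS, hS, h1, ← Finset.sum_add_distrib]
    refine Finset.sum_congr rfl fun j _ => ?_
    rcases lt_trichotomy (i : ℕ) j with h | h | h
    · simp [h.le, Nat.succ_le_of_lt h, Fin.ext_iff, h.ne']
    · simp [h, Fin.ext_iff]
    · simp [Fin.ext_iff, h.ne, show ¬ (i : ℕ) ≤ j by omega, show ¬ (i : ℕ) + 1 ≤ j by omega]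
  have hSN : ∀ z, S N z = 0 := fun z => by
    rw [hS]
    exact Finset.sum_eq_zero fun j _ => if_neg (by omega)
  let e₁ : Fin N → V → WithLp 2 (H × H) := fun i ξ => WithLp.toLp 2 (PiLp.single 2 i ξ, 0)
  let e₂ : Fin N → V → WithLp 2 (H × H) := fun i ξ => WithLp.toLp 2 (0, PiLp.single 2 i ξ)
  have hsn : ∀ i ξ, ‖(PiLp.single 2 i ξ : H)‖ = ‖ξ‖ := PiLp.norm_single 2 (fun _ : Fin N => V)
  have he₁ : ∀ i ξ, ‖e₁ i ξ‖ = ‖ξ‖ := fun i ξ => by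
    rw [← hsn i ξ]
    exact WithLp.norm_toLp_fst 2 H H _
  have he₂ : ∀ i ξ, ‖e₂ i ξ‖ = ‖ξ‖ := fun i ξ => by
    rw [← hsn i ξ]
    exact WithLp.norm_toLp_snd 2 H H _
  have hin : ∀ (a : H) i ξ, ⟪a, PiLp.single 2 i ξ⟫ = ⟪a i, ξ⟫ := fun a i ξ => by
    rw [PiLp.inner_apply, Finset.sum_eq_single i]
    · simp
    · intro j _ hj
      simp [hj]
    · simp
  have hS₁ : ∀ n i ξ, S n (e₁ i ξ) = 0 := fun n i ξ => by
    rw [hS]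
    simp [e₁]
  have hS₂ : ∀ n i ξ, S n (e₂ i ξ) = if n ≤ i then ξ else 0 := fun n i ξ => by
    rw [hS, Finset.sum_eq_single i]
    · simp [e₂]
    · intro j _ hj
      simp [e₂, hj]
    · simp
  let ℓ : Fin N → WithLp 2 (H × H) →L[ℝ] V × V := fun i =>
    ((PiLp.proj 2 (fun _ : Fin N => V) i).comp (WithLp.fstL 2 ℝ H H)).prod (-S (i + 1))
  have hℓ : ∀ i z, ℓ i z = (z.fst i, -S (i + 1) z) := fun i z => rfl
  obtain ⟨z, hz, hcrit⟩ := exists_almost_critical_pairing (k := fun i : Fin N => k i)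
    (fun i => hk i) (fun i => hs i) (fun i => h0 i) ℓ (fun _ => (0, y₁)) hδ
  let y : ℕ → V := fun n => y₁ - S n z
  let l : Fin N := ⟨N - 1, by omega⟩
  let g : V := (InnerProductSpace.toDual ℝ V).symm
    ((fderiv ℝ (k l) (z.fst l, y N)).comp (ContinuousLinearMap.inr ℝ V V))
  let x : ℕ → V := fun n => if h : n < N then z.fst ⟨n, h⟩ else z.fst l + g
  have hx : ∀ i : Fin N, x i = z.fst i := fun i => by simp [x]
  have hy : ∀ i : Fin N, y (i + 1) - y i = z.snd i := fun i => by
    simp only [y, hSsucc]; abel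
  have hpt : ∀ i : Fin N, ℓ i z + (0, y₁) = (x i, y (i + 1)) := fun i => by
    rw [hℓ, hx]
    simp [y, sub_eq_neg_add]
  simp only [hpt] at hz hcrit
  refine ⟨x, y, by simp [y, hSN], ?_, ?_, ?_, ?_⟩
  · have h1 := hcrit (e₂ ⟨0, hN⟩ (x 0))
    have h2 : ∀ i, ℓ i (e₂ ⟨0, hN⟩ (x 0)) = 0 := fun i => by
      rw [hℓ, hS₂]
      simp [e₂]
    simp only [h2, map_zero, Finset.sum_const_zero, he₂] at h1
    have h3 : ⟪z.fst, (e₂ ⟨0, hN⟩ (x 0)).snd⟫ = ⟪x 0, x 0⟫ := by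
      change ⟪z.fst, PiLp.single 2 _ _⟫ = _
      rw [hin, ← hx]
    have h4 : ⟪(e₂ ⟨0, hN⟩ (x 0)).fst, z.snd⟫ = 0 := inner_zero_left _
    rw [h3, h4, real_inner_self_eq_norm_sq] at h1
    rcases (norm_nonneg (x 0)).eq_or_lt with h5 | h5
    · rw [← h5]; exact hδ.le
    · have h6 := (le_abs_self _).trans h1
      nlinarith
  · intro i hi ξ
    have h1 := hcrit (e₁ ⟨i, hi⟩ ξ)
    have h2 : ∀ j, ℓ j (e₁ ⟨i, hi⟩ ξ) = if j = ⟨i, hi⟩ then (ξ, 0) else 0 := fun j => by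
      rw [hℓ, hS₁]
      split_ifs with h <;> simp [e₁, h]
    have h3 : ⟪z.fst, (e₁ ⟨i, hi⟩ ξ).snd⟫ = 0 := inner_zero_right _
    have h4 : ⟪(e₁ ⟨i, hi⟩ ξ).fst, z.snd⟫ = ⟪y (i + 1) - y i, ξ⟫ := by
      change ⟪PiLp.single 2 _ _, z.snd⟫ = _
      rw [real_inner_comm, hin, ← hy]
    rw [Finset.sum_eq_single ⟨i, hi⟩ (fun j _ hj => by rw [h2, if_neg hj, map_zero]) (by simp),
      h2, if_pos rfl, h3, h4, zero_add, he₁] at h1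
    exact h1
  · intro i hi ξ
    by_cases hi' : i + 1 < N
    · have h1 := hcrit (e₂ ⟨i, hi⟩ ξ - e₂ ⟨i + 1, hi'⟩ ξ)
      have h2 : ∀ j, ℓ j (e₂ ⟨i, hi⟩ ξ - e₂ ⟨i + 1, hi'⟩ ξ)
          = if j = ⟨i, hi⟩ then (0, ξ) else 0 := fun j => by
        rw [map_sub, hℓ, hℓ, hS₂, hS₂]
        rcases lt_trichotomy (j : ℕ) i with h | h | h
        · simp [e₂, Fin.ext_iff, h.ne, show (j : ℕ) + 1 ≤ i by omega, h.le]
        · simp [e₂, Fin.ext_iff, h]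
        · simp [e₂, Fin.ext_iff, h.ne', show ¬ (j : ℕ) + 1 ≤ i by omega, h]
      have h3 : ⟪z.fst, (e₂ ⟨i, hi⟩ ξ - e₂ ⟨i + 1, hi'⟩ ξ).snd⟫ = -⟪x (i + 1) - x i, ξ⟫ := by
        change ⟪z.fst, PiLp.single 2 _ _ - PiLp.single 2 _ _⟫ = _
        rw [inner_sub_right, hin, hin, ← hx, ← hx, inner_sub_left]
        ring
      have h4 : ⟪(e₂ ⟨i, hi⟩ ξ - e₂ ⟨i + 1, hi'⟩ ξ).fst, z.snd⟫ = 0 := by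
        change ⟪(0 : H) - 0, z.snd⟫ = 0
        rw [sub_zero, inner_zero_left]
      rw [Finset.sum_eq_single ⟨i, hi⟩ (fun j _ hj => by rw [h2, if_neg hj, map_zero]) (by simp),
        h2, if_pos rfl, h3, h4, add_zero] at h1
      rw [← abs_neg, neg_sub, sub_eq_neg_add]
      refine h1.trans ?_
      have h5 := norm_sub_le (e₂ ⟨i, hi⟩ ξ) (e₂ ⟨i + 1, hi'⟩ ξ)
      rw [he₂, he₂] at h5
      nlinarith
    · obtain rfl : i + 1 = N := by omega
      have h1 : x i = z.fst l := hx l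
      have h2 : x (i + 1) - x i = g := by
        rw [h1]
        simp [x]
      have h3 : ⟪g, ξ⟫ = fderiv ℝ (k i) (x i, y (i + 1)) (0, ξ) := by
        rw [h1]
        exact InnerProductSpace.toDual_symm_apply
      rw [h2, h3, sub_self, abs_zero]
      positivity
  · rw [Finset.sum_range, Finset.sum_add_distrib]
    refine hz.trans_eq ?_
    congr 1
    rw [PiLp.inner_apply]
    exact Finset.sum_congr rfl fun i _ => by rw [hx, hy]

end Discrete

section Hamiltonian

lemma exists_solution_Icc {Z : Type*} [NormedAddCommGroup Z] [NormedSpace ℝ Z] [CompleteSpace Z]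
    {g : ℝ × Z → Z} {L B : NNReal} (hL : LipschitzWith L g) (hB : ∀ p, ‖g p‖ ≤ B) (z₀ : Z) :
    ∃ z : ℝ → Z, z 0 = z₀ ∧
      ∀ t ∈ Icc (0 : ℝ) 1, HasDerivWithinAt z (g (t, z t)) (Icc 0 1) t := by
  have h : IsPicardLindelof (fun t z => g (t, z)) (⟨0, by simp⟩ : Icc (0 : ℝ) 1) z₀ B 0 B L := by
    refine ⟨fun t _ => ?_, fun x _ => ?_, fun t _ x _ => hB _, by simp⟩
    · exact (LipschitzWith.of_dist_le_mul fun x y => by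
        simpa [Prod.dist_eq] using hL.dist_le_mul (t, x) (t, y)).lipschitzOnWith
    · exact (hL.continuous.comp (by fun_prop)).continuousOn
  exact h.exists_eq_forall_mem_Icc_hasDerivWithinAt₀

/-- Discrete Gronwall estimate: an approximate Euler scheme with step `1 / N` stays at distance
`O(1 / N)` from the solution. -/
lemma norm_sub_solution_le {Z : Type*} [NormedAddCommGroup Z] [NormedSpace ℝ Z]
    {g : ℝ × Z → Z} {L B : NNReal} (hL : LipschitzWith L g) (hB : ∀ p, ‖g p‖ ≤ B) {z : ℝ → Z}
    (hz : ∀ t ∈ Icc (0 : ℝ) 1, HasDerivWithinAt z (g (t, z t)) (Icc 0 1) t) {N : ℕ} (hN : 0 < N)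
    {h : ℝ} (hh : h = 1 / N) {w p : ℕ → Z} (hw0 : ‖w 0 - z 0‖ ≤ h ^ 2)
    (hw : ∀ i < N, ‖w (i + 1) - w i - h • g (i * h, p i)‖ ≤ 2 * h ^ 2)
    (hp : ∀ i < N, ‖p i - w i‖ ≤ (B + 1) * h) :
    ∀ i ≤ N, ‖w i - z (i * h)‖ ≤ (3 + 2 * L * (B + 1)) * Real.exp L * h := by
  have hN' : (0 : ℝ) < N := by exact_mod_cast hN
  have hh0 : 0 < h := by rw [hh]; positivity
  have hNh : N * h = 1 := by rw [hh]; field_simp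
  set D : ℝ := 2 + 2 * L * (B + 1) with hD
  have hD0 : 0 ≤ D := by positivity
  have hmem : ∀ i : ℕ, i ≤ N → (i * h : ℝ) ∈ Icc (0 : ℝ) 1 := fun i hi => by
    refine ⟨by positivity, ?_⟩
    rw [← hNh]
    gcongr
  have hlip : ∀ s ∈ Icc (0 : ℝ) 1, ∀ t ∈ Icc (0 : ℝ) 1, ‖z t - z s‖ ≤ B * ‖t - s‖ :=
    fun s hs t ht => (convex_Icc 0 1).norm_image_sub_le_of_norm_hasDerivWithin_le hz
      (fun _ _ => hB _) hs ht
  have hstep : ∀ i < N, ‖z ((i + 1 : ℕ) * h) - z (i * h) - h • g (i * h, z (i * h))‖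
      ≤ L * (B + 1) * h ^ 2 := by
    intro i hi
    have hi1 := hmem i hi.le
    have hi2 := hmem (i + 1) hi
    have hsub : Icc (i * h : ℝ) ((i + 1 : ℕ) * h) ⊆ Icc 0 1 := Icc_subset_Icc hi1.1 hi2.2
    have hle : (i * h : ℝ) ≤ (i + 1 : ℕ) * h := by gcongr; simp
    have hdiff : ((i + 1 : ℕ) * h - i * h : ℝ) = h := by push_cast; ring
    have h1 := (convex_Icc (i * h : ℝ) ((i + 1 : ℕ) * h)).norm_image_sub_le_of_norm_hasDerivWithin_le
      (f := fun t => z t - t • g (i * h, z (i * h)))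
      (f' := fun t => g (t, z t) - (1 : ℝ) • g (i * h, z (i * h))) (C := L * (B + 1) * h)
      (fun t ht => ((hz t (hsub ht)).mono hsub).sub ((hasDerivWithinAt_id _ _).smul_const _))
      (fun t ht => ?_) (left_mem_Icc.2 hle) (right_mem_Icc.2 hle)
    · rw [hdiff, Real.norm_of_nonneg hh0.le] at h1
      have h2 : z ((i + 1 : ℕ) * h) - z (i * h) - h • g (i * h, z (i * h))
          = (z ((i + 1 : ℕ) * h) - (((i + 1 : ℕ) * h : ℝ)) • g (i * h, z (i * h)))
            - (z (i * h) - (i * h : ℝ) • g (i * h, z (i * h))) := by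
        rw [sub_sub_sub_comm, ← sub_smul, hdiff]
      rw [h2]
      refine h1.trans_eq (by ring)
    · rw [one_smul]
      have h3 := hL.norm_sub_le (t, z t) (i * h, z (i * h))
      refine h3.trans ?_
      have ht1 : ‖t - i * h‖ ≤ h := by
        rw [Real.norm_of_nonneg (sub_nonneg.2 ht.1)]
        linarith [ht.2]
      have ht2 := hlip _ hi1 t (hsub ht)
      rw [mul_assoc]
      gcongr
      rw [Prod.mk_sub_mk, Prod.norm_mk]
      have hBh : (B : ℝ) * ‖t - i * h‖ ≤ B * h := by gcongr
      have hBh0 : 0 ≤ (B : ℝ) * h := by positivity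
      refine max_le (by linarith) (by linarith)
  have hind : ∀ i ≤ N, ‖w i - z (i * h)‖ ≤ (h ^ 2 + i * (D * h ^ 2)) * (1 + h * L) ^ i := by
    intro i
    induction i with
    | zero => intro _; simpa using hw0
    | succ i ih =>
      intro hi
      have hE := ih (by omega)
      have h1 := hw i hi
      have h2 := hstep i hi
      have h3 : ‖g (i * h, p i) - g (i * h, z (i * h))‖
          ≤ L * ((B + 1) * h + ‖w i - z (i * h)‖) := by
        refine (hL.norm_sub_le _ _).trans ?_
        gcongr
        rw [Prod.mk_sub_mk, Prod.norm_mk, sub_self, norm_zero, max_eq_right (norm_nonneg _)]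
        calc _ = ‖(p i - w i) + (w i - z (i * h))‖ := by rw [sub_add_sub_cancel]
          _ ≤ _ := (norm_add_le _ _).trans (by gcongr; exact hp i hi)
      have h4 : w (i + 1) - z ((i + 1 : ℕ) * h)
          = (w (i + 1) - w i - h • g (i * h, p i))
            - (z ((i + 1 : ℕ) * h) - z (i * h) - h • g (i * h, z (i * h)))
            + ((w i - z (i * h)) + h • (g (i * h, p i) - g (i * h, z (i * h)))) := by
        rw [smul_sub]; abel
      have h5 : ‖w (i + 1) - z ((i + 1 : ℕ) * h)‖ ≤ 2 * h ^ 2 + L * (B + 1) * h ^ 2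
          + (‖w i - z (i * h)‖ + h * (L * ((B + 1) * h + ‖w i - z (i * h)‖))) := by
        rw [h4]
        refine (norm_add_le _ _).trans (add_le_add ((norm_sub_le _ _).trans (add_le_add h1 h2)) ?_)
        refine (norm_add_le _ _).trans (add_le_add le_rfl ?_)
        rw [norm_smul, Real.norm_of_nonneg hh0.le]
        gcongr
      have h6 : (1 : ℝ) ≤ (1 + h * L) ^ (i + 1) := one_le_pow₀ (by
        have : 0 ≤ h * L := by positivity
        linarith)
      calc _ ≤ (1 + h * L) * ‖w i - z (i * h)‖ + D * h ^ 2 := by rw [hD]; linarith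
        _ ≤ (1 + h * L) * ((h ^ 2 + i * (D * h ^ 2)) * (1 + h * L) ^ i)
            + D * h ^ 2 * (1 + h * L) ^ (i + 1) := by
          refine add_le_add (by gcongr) ?_
          exact le_mul_of_one_le_right (by positivity) h6
        _ = _ := by push_cast; ring
  intro i hi
  have hiN : (i : ℝ) * h ≤ 1 := (hmem i hi).2
  have h1h : h ≤ 1 := by
    rw [hh, div_le_one hN']
    exact_mod_cast hN
  refine (hind i hi).trans ?_
  have h1 : (1 + h * L) ^ i ≤ Real.exp L := by
    calc (1 + h * L) ^ i ≤ Real.exp (h * L) ^ i := by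
          gcongr
          linarith [Real.add_one_le_exp (h * L)]
      _ = Real.exp (i * h * L) := by rw [← Real.exp_nat_mul]; ring_nf
      _ ≤ Real.exp L := by
        gcongr
        exact mul_le_of_le_one_left (by positivity) hiN
  have h2 : h ^ 2 + i * (D * h ^ 2) ≤ (1 + D) * h := by
    have e1 : h ^ 2 ≤ h := by nlinarith
    have e2 : i * h * (D * h) ≤ 1 * (D * h) := by gcongr
    nlinarith
  calc _ ≤ (1 + D) * h * Real.exp L := by gcongr
    _ = _ := by rw [hD]; ring

variable {V : Type*} [NormedAddCommGroup V] [InnerProductSpace ℝ V]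

lemma norm_le_exp_mul_norm {y y' : ℝ → V} {C : ℝ}
    (hy : ∀ t ∈ Icc (0 : ℝ) 1, HasDerivWithinAt y (y' t) (Icc 0 1) t)
    (hC : ∀ t ∈ Icc (0 : ℝ) 1, ‖y' t‖ ≤ C * ‖y t‖) {s t : ℝ} (hs : s ∈ Icc (0 : ℝ) 1)
    (ht : t ∈ Icc (0 : ℝ) 1) : ‖y s‖ ≤ Real.exp (C * |s - t|) * ‖y t‖ := by
  have hin : ∀ t ∈ Icc (0 : ℝ) 1, |⟪y t, y' t⟫| ≤ C * ‖y t‖ ^ 2 := fun t ht => by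
    refine (abs_real_inner_le_norm _ _).trans ?_
    have := mul_le_mul_of_nonneg_left (hC t ht) (norm_nonneg (y t))
    nlinarith
  have hder : ∀ c : ℝ, ∀ t ∈ Icc (0 : ℝ) 1, HasDerivWithinAt
      (fun t => Real.exp (c * t) * ‖y t‖ ^ 2)
      (Real.exp (c * t) * (c * 1) * ‖y t‖ ^ 2 + Real.exp (c * t) * (2 * ⟪y t, y' t⟫))
      (Icc 0 1) t := fun c t ht =>
    (((hasDerivWithinAt_id t _).const_mul c).exp).mul (hy t ht).norm_sq
  have hcont : ∀ c : ℝ, ContinuousOn (fun t => Real.exp (c * t) * ‖y t‖ ^ 2) (Icc 0 1) :=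
    fun c t ht => (hder c t ht).continuousWithinAt
  have hmono : MonotoneOn (fun t => Real.exp (2 * C * t) * ‖y t‖ ^ 2) (Icc 0 1) := by
    refine monotoneOn_of_hasDerivWithinAt_nonneg (convex_Icc 0 1) (hcont _)
      (fun t ht => (hder _ t (interior_subset ht)).mono interior_subset) fun t ht => ?_
    have h1 := (abs_le.1 (hin t (interior_subset ht))).1
    have h2 := Real.exp_pos (2 * C * t)
    nlinarith
  have hanti : AntitoneOn (fun t => Real.exp (-(2 * C) * t) * ‖y t‖ ^ 2) (Icc 0 1) := by
    refine antitoneOn_of_hasDerivWithinAt_nonpos (convex_Icc 0 1) (hcont _)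
      (fun t ht => (hder _ t (interior_subset ht)).mono interior_subset) fun t ht => ?_
    have h1 := (abs_le.1 (hin t (interior_subset ht))).2
    have h2 := Real.exp_pos (-(2 * C) * t)
    nlinarith
  rw [← abs_norm (y s), ← abs_of_pos (Real.exp_pos (C * |s - t|)), ← abs_norm (y t), ← abs_mul]
  refine sq_le_sq.1 ?_
  rw [mul_pow, ← Real.exp_nat_mul]
  rcases le_total s t with h | h
  · have h1 := hmono hs ht h
    rw [abs_sub_comm, abs_of_nonneg (sub_nonneg.2 h)]
    have h2 : Real.exp ((2 : ℕ) * (C * (t - s))) = Real.exp (2 * C * t) / Real.exp (2 * C * s) := by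
      rw [← Real.exp_sub]; congr 1; push_cast; ring
    rw [h2, div_mul_eq_mul_div, le_div_iff₀ (Real.exp_pos _), mul_comm]
    exact h1
  · have h1 := hanti ht hs h
    rw [abs_of_nonneg (sub_nonneg.2 h)]
    have h2 : Real.exp ((2 : ℕ) * (C * (s - t)))
        = Real.exp (-(2 * C) * t) / Real.exp (-(2 * C) * s) := by
      rw [← Real.exp_sub]; congr 1; push_cast; ring
    rw [h2, div_mul_eq_mul_div, le_div_iff₀ (Real.exp_pos _), mul_comm]
    exact h1

lemma norm_sub_le_of_abs_inner_le {a b : V} {c : ℝ} (hc : 0 ≤ c)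
    (h : ∀ ξ, |⟪a, ξ⟫ - ⟪b, ξ⟫| ≤ c * ‖ξ‖) : ‖a - b‖ ≤ c := by
  have h1 := (le_abs_self _).trans (h (a - b))
  rw [← inner_sub_left, real_inner_self_eq_norm_sq] at h1
  rcases (norm_nonneg (a - b)).eq_or_lt with h5 | h5
  · rwa [← h5]
  · nlinarith

variable [FiniteDimensional ℝ V]

/-- The Hamiltonian vector field `(K_y, -K_x)` of a time-dependent Hamiltonian. -/
def hamField (K : ℝ × V × V → ℝ) (p : ℝ × V × V) : V × V :=
  ((InnerProductSpace.toDual ℝ V).symm ((fderiv ℝ K p).comp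
      ((ContinuousLinearMap.inr ℝ ℝ (V × V)).comp (ContinuousLinearMap.inr ℝ V V))),
    -(InnerProductSpace.toDual ℝ V).symm ((fderiv ℝ K p).comp
      ((ContinuousLinearMap.inr ℝ ℝ (V × V)).comp (ContinuousLinearMap.inl ℝ V V))))

lemma inner_hamField_fst (K : ℝ × V × V → ℝ) (p : ℝ × V × V) (ξ : V) :
    ⟪(hamField K p).1, ξ⟫ = fderiv ℝ K p (0, 0, ξ) :=
  InnerProductSpace.toDual_symm_apply

lemma inner_hamField_snd (K : ℝ × V × V → ℝ) (p : ℝ × V × V) (ξ : V) :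
    ⟪(hamField K p).2, ξ⟫ = -fderiv ℝ K p (0, ξ, 0) := by
  rw [hamField, inner_neg_left]
  exact congrArg _ InnerProductSpace.toDual_symm_apply

lemma contDiff_hamField {K : ℝ × V × V → ℝ} (hK : ContDiff ℝ 2 K) :
    ContDiff ℝ 1 (hamField K) := by
  have hf : ContDiff ℝ 1 (fderiv ℝ K) := hK.fderiv_right (by norm_num)
  let D : (V →L[ℝ] ℝ) →L[ℝ] V := LinearMap.mkContinuous
      { toFun := fun l => (InnerProductSpace.toDual ℝ V).symm l, map_add' := fun _ _ => map_add _ _ _,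
        map_smul' := fun c l => by simp } 1 fun l => by simp
  have hD : ∀ A : V →L[ℝ] ℝ × V × V, ContDiff ℝ 1 fun p =>
      (InnerProductSpace.toDual ℝ V).symm ((fderiv ℝ K p).comp A) := fun A =>
    D.contDiff.comp (hf.clm_comp contDiff_const)
  exact (hD _).prodMk (hD _).neg

lemma hasCompactSupport_hamField {K : ℝ × V × V → ℝ} (hs : HasCompactSupport K) :
    HasCompactSupport (hamField K) := by
  refine (hs.fderiv ℝ).mono' fun p hp => subset_tsupport _ ?_
  rw [Function.mem_support] at hp ⊢
  contrapose! hp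
  simp [hamField, hp]

/-- A compactly supported non-negative Hamiltonian, homogeneous of degree one in the momentum on a
large annulus, has a trajectory starting on the fibre over `0`, with final momentum close to a
given unit vector, and with almost non-negative pairing of the final position and momentum. -/
theorem exists_hamiltonian_trajectory {K : ℝ × V × V → ℝ} (hK : ContDiff ℝ 2 K)
    (hs : HasCompactSupport K) (h0 : ∀ p, 0 ≤ K p) {C : ℝ} (hC0 : 0 ≤ C)
    (hC : ∀ p, ‖(hamField K p).2‖ ≤ C * ‖p.2.2‖)
    (hE : ∀ t x y, Real.exp (-C) / 4 < ‖y‖ → ‖y‖ < 2 * Real.exp C →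
      ⟪(hamField K (t, x, y)).1, y⟫ = K (t, x, y)) {y₁ : V} (hy₁ : ‖y₁‖ = 1) {ε : ℝ} (hε : 0 < ε) :
    ∃ z : ℝ → V × V, (z 0).1 = 0 ∧
      (∀ t ∈ Icc (0 : ℝ) 1, HasDerivWithinAt z (hamField K (t, z t)) (Icc 0 1) t) ∧
      (∀ t ∈ Icc (0 : ℝ) 1, Real.exp (-C) / 4 < ‖(z t).2‖ ∧ ‖(z t).2‖ < 2 * Real.exp C) ∧
      ‖(z 1).2 - y₁‖ ≤ ε ∧ -ε ≤ ⟪(z 1).1, (z 1).2⟫ := by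
  have hg := contDiff_hamField hK
  have hgs := hasCompactSupport_hamField hs
  obtain ⟨L, hL⟩ := hg.lipschitzWith_of_hasCompactSupport hgs one_ne_zero
  obtain ⟨B', hB'⟩ := hgs.exists_bound_of_continuous hg.continuous
  obtain ⟨B, hB⟩ : ∃ B : NNReal, ∀ p, ‖hamField K p‖ ≤ B :=
    ⟨B'.toNNReal, fun p => (hB' p).trans (Real.le_coe_toNNReal _)⟩
  set D : ℝ := (3 + 2 * L * (B + 1)) * Real.exp L with hD
  have hD0 : 0 < D := by positivity
  set e := Real.exp C with he
  set c := Real.exp (-C) with hc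
  have hce : c * e = 1 := by rw [he, hc, ← Real.exp_add]; simp
  have hc0 : 0 < c := Real.exp_pos _
  have he1 : 1 ≤ e := Real.one_le_exp hC0
  have hc1 : c ≤ 1 := by nlinarith
  obtain ⟨n, hn⟩ := exists_nat_one_div_lt
    (show 0 < min (c / (4 * D)) (ε / (D * (B + 1) + 6 * e)) by positivity)
  set N := n + 1 with hNdef
  have hN : 0 < N := by omega
  set h : ℝ := 1 / N with hh
  have hh0 : 0 < h := by positivity
  have hNh : N * h = 1 := by rw [hh]; field_simp
  have hh1 : h ≤ 1 := by
    rw [hh, div_le_one (by positivity)]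
    exact_mod_cast hN
  have hhm : h < min (c / (4 * D)) (ε / (D * (B + 1) + 6 * e)) := by
    rw [hh, hNdef]; push_cast; exact hn
  have hhc : D * h ≤ c / 4 := by
    have := (lt_min_iff.1 hhm).1
    rw [lt_div_iff₀ (by positivity)] at this
    linarith
  have hhε : D * h * (B + 1) + 6 * e * h ≤ ε := by
    have := (lt_min_iff.1 hhm).2
    rw [lt_div_iff₀ (by positivity)] at this
    linarith
  clear hhm hn
  let k : ℕ → V × V → ℝ := fun i q => h * K (i * h, q)
  have hkd : ∀ i q v, fderiv ℝ (k i) q v = h * fderiv ℝ K (i * h, q) (0, v) := by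
    intro i q v
    have h1 : HasFDerivAt K (fderiv ℝ K (i * h, q)) (i * h, q) :=
      (hK.differentiable (by norm_num) _).hasFDerivAt
    have h2 : HasFDerivAt (k i) _ q :=
      (h1.comp q (hasFDerivAt_prodMk_right (i * h : ℝ) q)).const_mul h
    rw [h2.fderiv]
    rfl
  obtain ⟨x, y, hyN, hx0, hy, hx, hact⟩ := exists_discrete_trajectory hN (k := k)
    (fun i => contDiff_const.mul (hK.comp (contDiff_const.prodMk contDiff_id)))
    (fun i => (hs.comp_isClosedEmbedding (Function.LeftInverse.isClosedEmbedding
      (f := Prod.snd) (g := fun q : V × V => ((i * h : ℝ), q)) (fun _ => rfl) continuous_snd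
      (by fun_prop))).mul_left)
    (fun i q => mul_nonneg hh0.le (h0 _)) y₁ (δ := h ^ 2) (by positivity)
  obtain ⟨z, hz0, hz⟩ := exists_solution_Icc hL hB ((0 : V), y 0)
  let w : ℕ → V × V := fun i => (x i, y i)
  let p : ℕ → V × V := fun i => (x i, y (i + 1))
  have hy' : ∀ i < N, ‖y (i + 1) - y i - h • (hamField K (i * h, p i)).2‖ ≤ h ^ 2 := fun i hi => by
    refine norm_sub_le_of_abs_inner_le (by positivity) fun ξ => ?_
    have h1 := hy i hi ξ
    rw [hkd] at h1
    rw [real_inner_smul_left, inner_hamField_snd, mul_neg, sub_neg_eq_add]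
    exact h1
  have hx' : ∀ i < N, ‖x (i + 1) - x i - h • (hamField K (i * h, p i)).1‖ ≤ 2 * h ^ 2 :=
    fun i hi => by
    refine norm_sub_le_of_abs_inner_le (by positivity) fun ξ => ?_
    have h1 := hx i hi ξ
    rw [hkd] at h1
    rw [real_inner_smul_left, inner_hamField_fst]
    exact h1
  have hclose := norm_sub_solution_le hL hB hz hN hh (w := w) (p := p) (by
      rw [hz0]
      simpa [w] using hx0) (fun i hi => by
      refine max_le (hx' i hi) ((hy' i hi).trans ?_)
      nlinarith [sq_nonneg h]) (fun i hi => by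
      have h1 : p i - w i = (0, y (i + 1) - y i) := by simp [p, w]
      rw [h1, Prod.norm_mk, norm_zero, max_eq_right (norm_nonneg _)]
      have h2 : y (i + 1) - y i = (y (i + 1) - y i - h • (hamField K (i * h, p i)).2)
        + h • (hamField K (i * h, p i)).2 := by abel
      rw [h2]
      refine (norm_add_le _ _).trans ((add_le_add (hy' i hi) le_rfl).trans ?_)
      rw [norm_smul, Real.norm_of_nonneg hh0.le]
      have h3 : ‖(hamField K (i * h, p i)).2‖ ≤ B := (norm_snd_le _).trans (hB _)
      nlinarith)
  rw [← hD] at hclose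
  have hone : (1 : ℝ) ∈ Icc (0 : ℝ) 1 := by simp
  have hzy : ∀ t ∈ Icc (0 : ℝ) 1, HasDerivWithinAt (fun t => (z t).2)
      (hamField K (t, z t)).2 (Icc 0 1) t := fun t ht =>
    (ContinuousLinearMap.snd ℝ V V).hasFDerivAt.comp_hasDerivWithinAt t (hz t ht)
  have hzx : ∀ t ∈ Icc (0 : ℝ) 1, HasDerivWithinAt (fun t => (z t).1)
      (hamField K (t, z t)).1 (Icc 0 1) t := fun t ht =>
    (ContinuousLinearMap.fst ℝ V V).hasFDerivAt.comp_hasDerivWithinAt t (hz t ht)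
  have hwy : ∀ i ≤ N, ‖y i - (z (i * h)).2‖ ≤ D * h := fun i hi =>
    (norm_snd_le (w i - z (i * h))).trans (hclose i hi)
  have hzN : ‖w N - z 1‖ ≤ D * h := by
    have := hclose N le_rfl
    rwa [hNh] at this
  have hy1 : ‖(z 1).2 - y₁‖ ≤ D * h := by
    rw [norm_sub_rev, ← hyN]
    exact (norm_snd_le (w N - z 1)).trans hzN
  have hx1 : ‖(z 1).1 - x N‖ ≤ D * h := by
    rw [norm_sub_rev]
    exact (norm_fst_le (w N - z 1)).trans hzN
  have hybd1 : ‖(z 1).2‖ ≤ 5 / 4 := by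
    have := norm_le_norm_add_norm_sub' (z 1).2 y₁
    linarith
  have hybd2 : 3 / 4 ≤ ‖(z 1).2‖ := by
    have := norm_le_norm_add_norm_sub y₁ (z 1).2
    rw [norm_sub_rev] at this
    have := norm_le_norm_add_norm_sub' y₁ (z 1).2
    rw [norm_sub_rev] at this
    linarith
  have hexp : ∀ s ∈ Icc (0 : ℝ) 1, ∀ t ∈ Icc (0 : ℝ) 1, ‖(z s).2‖ ≤ e * ‖(z t).2‖ := by
    intro s hs t ht
    refine (norm_le_exp_mul_norm hzy (fun t _ => hC _) hs ht).trans ?_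
    refine mul_le_mul_of_nonneg_right (Real.exp_le_exp.2 ?_) (norm_nonneg _)
    refine mul_le_of_le_one_right hC0 (abs_le.2 ⟨?_, ?_⟩) <;> linarith [hs.1, hs.2, ht.1, ht.2]
  have hup : ∀ t ∈ Icc (0 : ℝ) 1, ‖(z t).2‖ ≤ 5 / 4 * e := fun t ht => by
    have := hexp t ht 1 hone
    nlinarith
  have hlow : ∀ t ∈ Icc (0 : ℝ) 1, 3 / 4 * c ≤ ‖(z t).2‖ := fun t ht => by
    have h1 := hexp 1 hone t ht
    have h2 : c * (3 / 4) ≤ c * (e * ‖(z t).2‖) :=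
      mul_le_mul_of_nonneg_left (hybd2.trans h1) hc0.le
    rw [← mul_assoc, hce, one_mul] at h2
    linarith
  have hmem : ∀ i : ℕ, i ≤ N → (i * h : ℝ) ∈ Icc (0 : ℝ) 1 := fun i hi => by
    refine ⟨by positivity, ?_⟩
    rw [← hNh]
    gcongr
  have hdisc1 : ∀ i ≤ N, c / 4 < ‖y i‖ := fun i hi => by
    have h1 := hlow _ (hmem i hi)
    have h2 := norm_le_norm_add_norm_sub (y i) (z (i * h)).2
    have h3 := hwy i hi
    linarith
  have hdisc2 : ∀ i ≤ N, ‖y i‖ < 2 * e := fun i hi => by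
    have h1 := hup _ (hmem i hi)
    have h2 := norm_le_norm_add_norm_sub' (y i) (z (i * h)).2
    have h3 := hwy i hi
    linarith
  refine ⟨z, by rw [hz0], hz, fun t ht => ⟨?_, ?_⟩, ?_, ?_⟩
  · linarith [hlow t ht]
  · linarith [hup t ht]
  · refine hy1.trans (le_trans ?_ hhε)
    have : 0 ≤ D * h * B := by positivity
    have : 0 ≤ 6 * e * h := by positivity
    linarith
  have hB0 : 0 ≤ (B : ℝ) := B.2
  have htel : ⟪x N, y N⟫ - ⟪x 0, y 0⟫ = ∑ i ∈ Finset.range N,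
      (⟪x i, y (i + 1) - y i⟫ + ⟪x (i + 1) - x i, y (i + 1)⟫) := by
    rw [← Finset.sum_range_sub (fun i => ⟪x i, y i⟫)]
    refine Finset.sum_congr rfl fun i _ => ?_
    rw [inner_sub_right, inner_sub_left]
    ring
  have hterm : ∀ i ∈ Finset.range N, (⟪x i, y (i + 1) - y i⟫ + k i (x i, y (i + 1))) - 4 * e * h ^ 2
      ≤ ⟪x i, y (i + 1) - y i⟫ + ⟪x (i + 1) - x i, y (i + 1)⟫ := by
    intro i hi
    rw [Finset.mem_range] at hi
    have h1 := hE (i * h) (x i) (y (i + 1)) (hdisc1 _ hi) (hdisc2 _ hi)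
    have h2 := (abs_le.1 ((abs_real_inner_le_norm
      (x (i + 1) - x i - h • (hamField K (i * h, p i)).1) (y (i + 1))))).1
    rw [inner_sub_left, real_inner_smul_left] at h2
    simp only [p] at h2
    rw [h1] at h2
    have h3 : ‖x (i + 1) - x i - h • (hamField K (i * h, p i)).1‖ * ‖y (i + 1)‖
        ≤ 2 * h ^ 2 * (2 * e) :=
      mul_le_mul (hx' i hi) (hdisc2 _ hi).le (norm_nonneg _) (by positivity)
    simp only [p, k] at h3 ⊢
    linarith
  have hsum := Finset.sum_le_sum hterm
  rw [Finset.sum_sub_distrib, ← htel, Finset.sum_const, Finset.card_range, nsmul_eq_mul] at hsum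
  have hN2 : (N : ℝ) * (4 * e * h ^ 2) = 4 * e * h := by
    linear_combination 4 * e * h * hNh
  have h1 : -(2 * e * h) ≤ ⟪x 0, y 0⟫ := by
    have h2 := (abs_le.1 (abs_real_inner_le_norm (x 0) (y 0))).1
    have h3 : ‖x 0‖ * ‖y 0‖ ≤ h ^ 2 * (2 * e) :=
      mul_le_mul hx0 (hdisc2 0 (by omega)).le (norm_nonneg _) (by positivity)
    have h4 : h ^ 2 * (2 * e) ≤ h * (2 * e) := by
      gcongr
      nlinarith
    linarith
  have hfin : ⟪(z 1).1, (z 1).2⟫ = ⟪x N, y N⟫ + ⟪(z 1).1, (z 1).2 - y₁⟫ + ⟪(z 1).1 - x N, y₁⟫ := by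
    rw [hyN, inner_sub_right, inner_sub_left]
    ring
  have hz1 : ‖(z 1).1‖ ≤ B := by
    have h2 := (convex_Icc (0 : ℝ) 1).norm_image_sub_le_of_norm_hasDerivWithin_le hzx
      (fun t _ => (norm_fst_le _).trans (hB _)) (left_mem_Icc.2 zero_le_one) hone
    rw [hz0] at h2
    simpa using h2
  have h5 := (abs_le.1 (abs_real_inner_le_norm (z 1).1 ((z 1).2 - y₁))).1
  have h6 := (abs_le.1 (abs_real_inner_le_norm ((z 1).1 - x N) y₁)).1
  have h7 : ‖(z 1).1‖ * ‖(z 1).2 - y₁‖ ≤ B * (D * h) :=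
    mul_le_mul hz1 hy1 (norm_nonneg _) hB0
  rw [hy₁, mul_one] at h6
  rw [hfin]
  linarith

end Hamiltonian

section Extension

lemma exists_local_left_inverse {A B : Type*} [NormedAddCommGroup A] [NormedSpace ℝ A]
    [FiniteDimensional ℝ A] [NormedAddCommGroup B] [NormedSpace ℝ B] [FiniteDimensional ℝ B]
    {n : WithTop ℕ∞} {Φ : A → B} {a : A} (hΦ : ContDiffAt ℝ n Φ a) (hn : n ≠ 0)
    (hinj : ∀ v, fderiv ℝ Φ a v = 0 → v = 0) :
    ∃ G : B → A, ContDiffAt ℝ n G (Φ a) ∧ ∀ᶠ a' in nhds a, G (Φ a') = a' := by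
  obtain ⟨P, hP⟩ := (fderiv ℝ Φ a).toLinearMap.exists_leftInverse_of_injective
    (LinearMap.ker_eq_bot'.2 hinj)
  have hd : HasFDerivAt (fun x => P.toContinuousLinearMap (Φ x))
      ((ContinuousLinearEquiv.refl ℝ A : A ≃L[ℝ] A) : A →L[ℝ] A) a := by
    refine (P.toContinuousLinearMap.hasFDerivAt.comp a
      (hΦ.differentiableAt hn).hasFDerivAt).congr_fderiv ?_
    ext v
    simpa using LinearMap.congr_fun hP v
  have hc : ContDiffAt ℝ n (fun x => P.toContinuousLinearMap (Φ x)) a :=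
    P.toContinuousLinearMap.contDiff.contDiffAt.comp a hΦ
  refine ⟨fun b => hc.localInverse hd hn (P.toContinuousLinearMap b), ?_, ?_⟩
  · exact (hc.to_localInverse hd hn).comp (Φ a) P.toContinuousLinearMap.contDiff.contDiffAt
  · exact (hc.hasStrictFDerivAt' hd hn).eventually_left_inverse

lemma exists_contDiff_pos_extension {A B : Type*} [NormedAddCommGroup A] [NormedSpace ℝ A]
    [NormedAddCommGroup B] [NormedSpace ℝ B] [FiniteDimensional ℝ B]
    {n : ℕ} {Φ : A → B} {S : Set A} {H : A → ℝ} (hS : IsCompact S) (hΦ : ContinuousOn Φ S)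
    (hinj : InjOn Φ S)
    (hloc : ∀ a ∈ S, ∃ G : B → A, ContDiffAt ℝ n G (Φ a) ∧ ∀ᶠ a' in nhds a, G (Φ a') = a')
    (hH : ∀ a ∈ S, ContDiffAt ℝ n H a) (hpos : ∀ a ∈ S, 0 < H a) :
    ∃ h : B → ℝ, ContDiff ℝ n h ∧ (∀ b, 0 < h b) ∧ ∀ a ∈ S, h (Φ a) = H a := by
  have key := exists_contMDiffMap_forall_mem_convex_of_local (I := modelWithCornersSelf ℝ B)
    (n := n) (t := fun w => {r : ℝ | 0 < r ∧ ∀ a ∈ S, Φ a = w → r = H a}) ?_ ?_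
  · obtain ⟨g, hg⟩ := key
    exact ⟨g, g.contMDiff.contDiff, fun b => (hg b).1, fun a ha => (hg (Φ a)).2 a ha rfl⟩
  · intro w
    by_cases hw : ∃ a ∈ S, Φ a = w
    · obtain ⟨a, ha, haw⟩ := hw
      intro x hx y hy p q hp hq hpq
      have h1 := hx.2 a ha haw
      have h2 := hy.2 a ha haw
      have h3 : p • x + q • y = x := by
        rw [h2.trans h1.symm, ← add_smul, hpq, one_smul]
      rw [h3]
      exact hx
    · intro x hx y hy p q hp hq hpq
      exact ⟨(convex_Ioi (0 : ℝ)) hx.1 hy.1 hp hq hpq, fun a ha h => (hw ⟨a, ha, h⟩).elim⟩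
  · intro w
    by_cases hw : w ∈ Φ '' S
    · obtain ⟨a, ha, rfl⟩ := hw
      obtain ⟨G, hG, hGe⟩ := hloc a ha
      have hGa : G (Φ a) = a := hGe.self_of_nhds
      have hc : ContDiffAt ℝ n (fun y => H (G y)) (Φ a) :=
        ContDiffAt.comp (Φ a) (by rw [hGa]; exact hH a ha) hG
      have h1 : ∀ᶠ y in nhds (Φ a), 0 < H (G y) :=
        hc.continuousAt.eventually (lt_mem_nhds (by simpa only [hGa] using hpos a ha))
      obtain ⟨N, hN, hNo, haN⟩ := _root_.eventually_nhds_iff.1 hGe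
      have h2 : ∀ᶠ y in nhds (Φ a), ∀ a' ∈ S, Φ a' = y → a' ∈ N := by
        have hcl : IsClosed (Φ '' (S \ N)) :=
          ((hS.diff hNo).image_of_continuousOn (hΦ.mono sdiff_subset)).isClosed
        have hna : Φ a ∉ Φ '' (S \ N) := by
          rintro ⟨a', ha', h⟩
          exact ha'.2 (hinj ha'.1 ha h ▸ haN)
        filter_upwards [hcl.isOpen_compl.mem_nhds hna] with y hy a' ha' h
        by_contra hcon
        exact hy ⟨a', ⟨ha', hcon⟩, h⟩
      obtain ⟨u, hu, huc⟩ := hc.contDiffOn le_rfl (by simp)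
      refine ⟨_, Filter.inter_mem hu (h1.and h2), fun y => H (G y),
        (huc.mono fun y hy => ?_).contMDiffOn, fun y hy => ⟨hy.2.1, fun a' ha' h => ?_⟩⟩
      · exact hy.1
      · have h3 := hN a' (hy.2.2 a' ha' h)
        rw [h] at h3
        change H (G y) = H a'
        rw [h3]
    · refine ⟨(Φ '' S)ᶜ, (hS.image_of_continuousOn hΦ).isClosed.isOpen_compl.mem_nhds hw,
        fun _ => 1, contMDiffOn_const, fun y hy => ⟨one_pos, fun a ha h => (hy ⟨a, ha, h⟩).elim⟩⟩

end Extension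

section Conic

variable {V : Type*} [NormedAddCommGroup V] [InnerProductSpace ℝ V]

/-- A positive isotopy of conic Lagrangian submanifolds of `V × V`, parametrised by `V \ {0}`:
`Ψ (σ, t) = (x, y)` is homogeneous of degree `0` in the position `x` and `1` in the momentum `y`. -/
structure IsConicIsotopy (Ψ : V × ℝ → V × V) : Prop where
  smooth : ∀ σ ≠ 0, ∀ t, ContDiffAt ℝ 3 Ψ (σ, t)
  fst_smul : ∀ c : ℝ, 0 < c → ∀ σ t, (Ψ (c • σ, t)).1 = (Ψ (σ, t)).1
  snd_smul : ∀ c : ℝ, 0 < c → ∀ σ t, (Ψ (c • σ, t)).2 = c • (Ψ (σ, t)).2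
  norm_snd : ∀ σ ≠ 0, ∀ t ∈ Icc (0 : ℝ) 1, ‖(Ψ (σ, t)).2‖ = ‖σ‖
  isotropic : ∀ σ ≠ 0, ∀ t ∈ Icc (0 : ℝ) 1, ∀ v,
    ⟪(Ψ (σ, t)).2, (fderiv ℝ Ψ (σ, t) (v, 0)).1⟫ = 0
  immersive : ∀ σ ≠ 0, ∀ t ∈ Icc (0 : ℝ) 1, ∀ v, fderiv ℝ Ψ (σ, t) (v, 0) = 0 → v = 0
  inj : ∀ t ∈ Icc (0 : ℝ) 1, InjOn (fun σ => Ψ (σ, t)) {σ | σ ≠ 0}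
  pos : ∀ σ ≠ 0, ∀ t ∈ Icc (0 : ℝ) 1, 0 < ⟪(Ψ (σ, t)).2, (fderiv ℝ Ψ (σ, t) (0, 1)).1⟫

/-- The Hamiltonian of an isotopy `Ψ`, as a function of the parameters: the value of the Liouville
form `⟪y, dx⟫` on the velocity. -/
def conicHam (Ψ : V × ℝ → V × V) (a : V × ℝ) : ℝ :=
  ⟪(Ψ a).2, (fderiv ℝ Ψ a (0, 1)).1⟫

/-- The track of an isotopy `Ψ`. -/
def conicTrack (Ψ : V × ℝ → V × V) (a : V × ℝ) : ℝ × V × V :=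
  (a.2, Ψ a)

namespace IsConicIsotopy

variable {Ψ : V × ℝ → V × V}

lemma hasDerivAt_right (hΨ : IsConicIsotopy Ψ) {σ : V} (hσ : σ ≠ 0) (t : ℝ) :
    HasDerivAt (fun s => Ψ (σ, s)) (fderiv ℝ Ψ (σ, t) (0, 1)) t :=
  ((hΨ.smooth σ hσ t).differentiableAt (by norm_num)).hasFDerivAt.comp_hasDerivAt t
    ((hasDerivAt_const t σ).prodMk (hasDerivAt_id t))

lemma hasDerivAt_right_fst (hΨ : IsConicIsotopy Ψ) {σ : V} (hσ : σ ≠ 0) (t : ℝ) :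
    HasDerivAt (fun s => (Ψ (σ, s)).1) (fderiv ℝ Ψ (σ, t) (0, 1)).1 t :=
  (ContinuousLinearMap.fst ℝ V V).hasFDerivAt.comp_hasDerivAt t (hΨ.hasDerivAt_right hσ t)

lemma conicHam_smul (hΨ : IsConicIsotopy Ψ) {c : ℝ} (hc : 0 < c) {σ : V} (hσ : σ ≠ 0) (t : ℝ) :
    conicHam Ψ (c • σ, t) = c * conicHam Ψ (σ, t) := by
  have h1 := hΨ.hasDerivAt_right_fst (smul_ne_zero hc.ne' hσ) t
  simp only [hΨ.fst_smul c hc σ] at h1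
  have h2 := h1.unique (hΨ.hasDerivAt_right_fst hσ t)
  rw [conicHam, conicHam, h2, hΨ.snd_smul c hc, real_inner_smul_left]

lemma contDiffAt_conicHam (hΨ : IsConicIsotopy Ψ) {σ : V} (hσ : σ ≠ 0) (t : ℝ) :
    ContDiffAt ℝ 2 (conicHam Ψ) (σ, t) := by
  have h := hΨ.smooth σ hσ t
  exact (contDiff_snd.contDiffAt.comp _ (h.of_le (by norm_num))).inner ℝ
    (contDiff_fst.contDiffAt.comp _ ((h.fderiv_right (m := 2) (by norm_num)).clm_apply
      contDiffAt_const))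

lemma contDiffAt_conicTrack (hΨ : IsConicIsotopy Ψ) {σ : V} (hσ : σ ≠ 0) (t : ℝ) :
    ContDiffAt ℝ 3 (conicTrack Ψ) (σ, t) :=
  contDiff_snd.contDiffAt.prodMk (hΨ.smooth σ hσ t)

variable [FiniteDimensional ℝ V]

lemma exists_left_inverse_conicTrack (hΨ : IsConicIsotopy Ψ) {σ : V} (hσ : σ ≠ 0) {t : ℝ}
    (ht : t ∈ Icc (0 : ℝ) 1) :
    ∃ G : ℝ × V × V → V × ℝ, ContDiffAt ℝ 3 G (conicTrack Ψ (σ, t)) ∧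
      ∀ᶠ a in nhds (σ, t), G (conicTrack Ψ a) = a := by
  refine exists_local_left_inverse (hΨ.contDiffAt_conicTrack hσ t) (by norm_num) ?_
  rintro ⟨v, s⟩ h
  have hd := (hΨ.smooth σ hσ t).differentiableAt (by norm_num)
  have h1 : HasFDerivAt (conicTrack Ψ) _ (σ, t) := hasFDerivAt_snd.prodMk hd.hasFDerivAt
  rw [h1.fderiv, ContinuousLinearMap.prod_apply, Prod.mk_eq_zero] at h
  have hs : s = 0 := h.1
  subst hs
  rw [hΨ.immersive σ hσ t ht v h.2]
  rfl

lemma exists_compactSupport_extension (hΨ : IsConicIsotopy Ψ) :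
    ∃ h : ℝ × V × V → ℝ, ContDiff ℝ 2 h ∧ HasCompactSupport h ∧ (∀ p, 0 ≤ h p) ∧
      ∀ σ, ‖σ‖ = 1 → ∀ t ∈ Icc (0 : ℝ) 1, h (t, Ψ (σ, t)) = conicHam Ψ (σ, t) := by
  have hne : ∀ a ∈ sphere (0 : V) 1 ×ˢ Icc (0 : ℝ) 1, a.1 ≠ 0 := fun a ha h0 => by
    simpa [h0] using ha.1
  have hcompact : IsCompact (sphere (0 : V) 1 ×ˢ Icc (0 : ℝ) 1) :=
    (isCompact_sphere 0 1).prod isCompact_Icc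
  have hcont : ContinuousOn (conicTrack Ψ) (sphere (0 : V) 1 ×ˢ Icc (0 : ℝ) 1) := fun a ha =>
    (hΨ.contDiffAt_conicTrack (hne a ha) a.2).continuousAt.continuousWithinAt
  obtain ⟨h, hh, hpos, heq⟩ := exists_contDiff_pos_extension (n := 2) hcompact hcont
    (fun a ha b hb hab => by
      obtain ⟨h1, h2⟩ := Prod.ext_iff.1 hab
      obtain ⟨σ, t⟩ := a
      obtain ⟨τ, s⟩ := b
      obtain rfl : t = s := h1
      exact congrArg (·, t) (hΨ.inj t ha.2 (hne _ ha) (hne _ hb) h2))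
    (fun a ha => by
      obtain ⟨G, hG, hGe⟩ := hΨ.exists_left_inverse_conicTrack (hne a ha) ha.2
      exact ⟨G, hG.of_le (by norm_num), hGe⟩)
    (fun a ha => hΨ.contDiffAt_conicHam (hne a ha) a.2)
    (fun a ha => hΨ.pos a.1 (hne a ha) a.2 ha.2)
  obtain ⟨R, hR⟩ := (hcompact.image_of_continuousOn hcont).isBounded.subset_closedBall 0
  let b : ContDiffBump (0 : ℝ × V × V) := ⟨max R 1, max R 1 + 1, by positivity, by linarith⟩
  refine ⟨fun p => b p * h p, b.contDiff.mul hh, b.hasCompactSupport.mul_right,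
    fun p => mul_nonneg b.nonneg (hpos p).le, fun σ hσ t ht => ?_⟩
  have hmem : (σ, t) ∈ sphere (0 : V) 1 ×ˢ Icc (0 : ℝ) 1 := ⟨by simpa using hσ, ht⟩
  have h1 : b (t, Ψ (σ, t)) = 1 := b.one_of_mem_closedBall
    (closedBall_subset_closedBall (le_max_left _ _) (hR ⟨_, hmem, rfl⟩))
  change b (t, Ψ (σ, t)) * h (conicTrack Ψ (σ, t)) = _
  rw [h1, one_mul, heq _ hmem]

end IsConicIsotopy

end Conic

section Homogenization

variable {V : Type*} [NormedAddCommGroup V] [InnerProductSpace ℝ V]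

lemma contDiff_homogenize {h : ℝ × V × V → ℝ} (hh : ContDiff ℝ 2 h) {ρ : V → ℝ}
    (hρ : ContDiff ℝ 2 ρ) {a : ℝ} (ha : 0 < a) (hρa : ∀ y, ‖y‖ < a → ρ y = 0) :
    ContDiff ℝ 2 fun p : ℝ × V × V => ρ p.2.2 * (‖p.2.2‖ * h (p.1, p.2.1, ‖p.2.2‖⁻¹ • p.2.2)) := by
  rw [contDiff_iff_contDiffAt]
  intro p
  by_cases hp : p.2.2 = 0
  · refine (contDiffAt_const (c := (0 : ℝ))).congr_of_eventuallyEq ?_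
    have h1 : ∀ᶠ q : ℝ × V × V in nhds p, ‖q.2.2‖ < a :=
      (by fun_prop : Continuous fun q : ℝ × V × V => ‖q.2.2‖).continuousAt.eventually
        (gt_mem_nhds (by simpa [hp] using ha))
    filter_upwards [h1] with q hq
    rw [hρa _ hq, zero_mul]
  · have hy : ContDiffAt ℝ 2 (fun q : ℝ × V × V => q.2.2) p := by fun_prop
    have hn : ContDiffAt ℝ 2 (fun q : ℝ × V × V => ‖q.2.2‖) p := hy.norm ℝ hp
    have hi : ContDiffAt ℝ 2 (fun q : ℝ × V × V => ‖q.2.2‖⁻¹) p := hn.inv (norm_ne_zero_iff.2 hp)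
    exact (hρ.contDiffAt.comp p hy).mul (hn.mul (hh.contDiffAt.comp p
      (contDiffAt_fst.prodMk ((by fun_prop : ContDiffAt ℝ 2 (fun q : ℝ × V × V => q.2.1) p).prodMk
        (hi.smul hy)))))

variable [FiniteDimensional ℝ V]

lemma exists_contDiff_cutoff {a b : ℝ} (ha : 0 < a) (hb : 0 < b) :
    ∃ ρ : V → ℝ, ContDiff ℝ 2 ρ ∧ (∀ y, 0 ≤ ρ y) ∧ (∀ y, ρ y ≤ 1) ∧ (∀ y, ‖y‖ < a / 2 → ρ y = 0) ∧
      (∀ y, 2 * b ≤ ‖y‖ → ρ y = 0) ∧ ∀ y, a < ‖y‖ → ‖y‖ < b → ρ y = 1 := by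
  let f : ContDiffBump (0 : V) := ⟨a / 2, a, by positivity, by linarith⟩
  let g : ContDiffBump (0 : V) := ⟨b, 2 * b, by positivity, by linarith⟩
  refine ⟨fun y => g y * (1 - f y), g.contDiff.mul (contDiff_const.sub f.contDiff),
    fun y => mul_nonneg g.nonneg (sub_nonneg.2 f.le_one),
    fun y => mul_le_one₀ g.le_one (sub_nonneg.2 f.le_one) (sub_le_self _ f.nonneg),
    fun y hy => ?_, fun y hy => ?_, fun y hy hy' => ?_⟩
  · change g y * (1 - f y) = 0
    rw [f.one_of_mem_closedBall (by simpa using hy.le), sub_self, mul_zero]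
  · change g y * (1 - f y) = 0
    rw [g.zero_of_le_dist (by simpa using hy), zero_mul]
  · change g y * (1 - f y) = 1
    rw [f.zero_of_le_dist (by simpa using hy.le), g.one_of_mem_closedBall (by simpa using hy'.le),
      sub_zero, mul_one]

lemma exists_homogeneous_hamiltonian {h : ℝ × V × V → ℝ} (hh : ContDiff ℝ 2 h)
    (hs : HasCompactSupport h) (h0 : ∀ p, 0 ≤ h p) :
    ∃ C : ℝ, 0 ≤ C ∧ ∃ K : ℝ × V × V → ℝ, ContDiff ℝ 2 K ∧ HasCompactSupport K ∧ (∀ p, 0 ≤ K p) ∧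
      (∀ p, ‖(hamField K p).2‖ ≤ C * ‖p.2.2‖) ∧
      (∀ t x y, Real.exp (-C) / 4 < ‖y‖ → ‖y‖ < 2 * Real.exp C →
        ⟪(hamField K (t, x, y)).1, y⟫ = K (t, x, y)) ∧
      ∀ t x y, Real.exp (-C) / 4 < ‖y‖ → ‖y‖ < 2 * Real.exp C →
        K (t, x, y) = ‖y‖ * h (t, x, ‖y‖⁻¹ • y) := by
  obtain ⟨C, hC⟩ := (hh.continuous_fderiv (by norm_num)).bounded_above_of_compact_support
    (hs.fderiv ℝ)
  have hC0 : 0 ≤ C := (norm_nonneg _).trans (hC 0)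
  obtain ⟨ρ, hρ, hρ0, hρ1, hρa, hρb, hρab⟩ := exists_contDiff_cutoff (V := V)
    (a := Real.exp (-C) / 4) (b := 2 * Real.exp C) (by positivity) (by positivity)
  let K : ℝ × V × V → ℝ := fun p => ρ p.2.2 * (‖p.2.2‖ * h (p.1, p.2.1, ‖p.2.2‖⁻¹ • p.2.2))
  have hK : ContDiff ℝ 2 K := contDiff_homogenize hh hρ (by positivity) hρa
  have hKd : Differentiable ℝ K := hK.differentiable (by norm_num)
  have hKeq : ∀ t x y, Real.exp (-C) / 4 < ‖y‖ → ‖y‖ < 2 * Real.exp C →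
      K (t, x, y) = ‖y‖ * h (t, x, ‖y‖⁻¹ • y) := fun t x y h1 h2 => by
    simp only [K, hρab y h1 h2, one_mul]
  refine ⟨C, hC0, K, hK, ?_, fun p => mul_nonneg (hρ0 _) (mul_nonneg (norm_nonneg _) (h0 _)),
    fun p => ?_, fun t x y h1 h2 => ?_, hKeq⟩
  · obtain ⟨R, hR⟩ := hs.isBounded.subset_closedBall 0
    refine HasCompactSupport.intro (isCompact_closedBall (0 : ℝ × V × V)
      (max R (2 * (2 * Real.exp C)))) fun p hp => ?_
    by_contra hne
    have hne1 : ρ p.2.2 ≠ 0 := left_ne_zero_of_mul hne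
    have hne2 : h (p.1, p.2.1, ‖p.2.2‖⁻¹ • p.2.2) ≠ 0 :=
      right_ne_zero_of_mul (right_ne_zero_of_mul hne)
    have h1 := hR (subset_tsupport _ hne2)
    rw [mem_closedBall_zero_iff, norm_prod_le_iff, norm_prod_le_iff] at h1
    refine hp ?_
    rw [mem_closedBall_zero_iff, norm_prod_le_iff, norm_prod_le_iff]
    refine ⟨h1.1.trans (le_max_left _ _), h1.2.1.trans (le_max_left _ _), le_trans ?_
      (le_max_right _ _)⟩
    by_contra! hcon
    exact hne1 (hρb _ hcon.le)
  · obtain ⟨t, x, y⟩ := p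
    set ξ := (hamField K (t, x, y)).2 with hξ
    have h1 : fderiv ℝ K (t, x, y) (0, ξ, 0) =
        ρ y * (‖y‖ * fderiv ℝ h (t, x, ‖y‖⁻¹ • y) (0, ξ, 0)) := by
      have h2 : HasDerivAt (fun s : ℝ => K (t, x + s • ξ, y)) (fderiv ℝ K (t, x, y) (0, ξ, 0)) 0 := by
        simpa [HasLineDerivAt] using (hKd (t, x, y)).hasFDerivAt.hasLineDerivAt (0, ξ, 0)
      have h3 : HasDerivAt (fun s : ℝ => h (t, x + s • ξ, ‖y‖⁻¹ • y))
          (fderiv ℝ h (t, x, ‖y‖⁻¹ • y) (0, ξ, 0)) 0 := by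
        simpa [HasLineDerivAt] using
          (hh.differentiable (by norm_num) (t, x, ‖y‖⁻¹ • y)).hasFDerivAt.hasLineDerivAt (0, ξ, 0)
      exact h2.unique ((h3.const_mul ‖y‖).const_mul (ρ y))
    have h2 : ⟪ξ, ξ⟫ = _ := inner_hamField_snd (K := K) (p := (t, x, y)) (ξ := ξ)
    rw [h1, real_inner_self_eq_norm_sq] at h2
    have h3 : |fderiv ℝ h (t, x, ‖y‖⁻¹ • y) (0, ξ, 0)| ≤ C * ‖ξ‖ := by
      have h4 := (fderiv ℝ h (t, x, ‖y‖⁻¹ • y)).le_of_opNorm_le (hC _) (0, ξ, 0)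
      simpa [Prod.norm_def] using h4
    have h4 : ‖ξ‖ ^ 2 ≤ C * ‖y‖ * ‖ξ‖ := by
      have h5 : |ρ y * (‖y‖ * fderiv ℝ h (t, x, ‖y‖⁻¹ • y) (0, ξ, 0))| ≤
          1 * (‖y‖ * (C * ‖ξ‖)) := by
        rw [abs_mul, abs_mul, abs_norm, abs_of_nonneg (hρ0 y)]
        exact mul_le_mul (hρ1 y) (by gcongr) (by positivity) zero_le_one
      rw [h2]
      exact (neg_le_abs _).trans (h5.trans (by linarith))
    rcases eq_or_ne ξ 0 with h5 | h5
    · rw [h5, norm_zero]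
      positivity
    · have h6 := norm_pos_iff.2 h5
      change ‖ξ‖ ≤ C * ‖y‖
      nlinarith
  · have hy0 : 0 < ‖y‖ := lt_trans (by positivity) h1
    rw [inner_hamField_fst]
    have h3 : HasDerivAt (fun s : ℝ => K (t, x, y + s • y)) (fderiv ℝ K (t, x, y) (0, 0, y)) 0 := by
      simpa [HasLineDerivAt] using (hKd (t, x, y)).hasFDerivAt.hasLineDerivAt (0, 0, y)
    have h4 : HasDerivAt (fun s : ℝ => (1 + s) * K (t, x, y)) (K (t, x, y)) 0 := by
      simpa using ((hasDerivAt_id (0 : ℝ)).const_add 1).mul_const (K (t, x, y))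
    refine h3.unique (h4.congr_of_eventuallyEq ?_)
    have hcont : ContinuousAt (fun s : ℝ => ‖y + s • y‖) 0 := by fun_prop
    have h5 := hcont.eventually (lt_mem_nhds (by simpa using h1))
    have h6 := hcont.eventually (gt_mem_nhds (by simpa using h2))
    filter_upwards [h5, h6, lt_mem_nhds (show (-1 : ℝ) < 0 by norm_num)] with s hs1 hs2 hs3
    have hs4 : 0 < 1 + s := by linarith
    have h7 : y + s • y = (1 + s) • y := by rw [add_smul, one_smul]
    have h8 : ‖y + s • y‖⁻¹ • (y + s • y) = ‖y‖⁻¹ • y := by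
      rw [h7, norm_smul, Real.norm_of_nonneg hs4.le, smul_smul]
      congr 1
      field_simp
    rw [hKeq _ _ _ hs1 hs2, hKeq _ _ _ h1 h2, h8, h7, norm_smul, Real.norm_of_nonneg hs4.le,
      mul_assoc]

lemma IsConicIsotopy.exists_hamiltonian {Ψ : V × ℝ → V × V} (hΨ : IsConicIsotopy Ψ) :
    ∃ C : ℝ, 0 ≤ C ∧ ∃ K : ℝ × V × V → ℝ, ContDiff ℝ 2 K ∧ HasCompactSupport K ∧ (∀ p, 0 ≤ K p) ∧
      (∀ p, ‖(hamField K p).2‖ ≤ C * ‖p.2.2‖) ∧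
      (∀ t x y, Real.exp (-C) / 4 < ‖y‖ → ‖y‖ < 2 * Real.exp C →
        ⟪(hamField K (t, x, y)).1, y⟫ = K (t, x, y)) ∧
      ∀ t ∈ Icc (0 : ℝ) 1, ∀ σ, Real.exp (-C) / 4 < ‖σ‖ → ‖σ‖ < 2 * Real.exp C →
        K (t, Ψ (σ, t)) = conicHam Ψ (σ, t) := by
  obtain ⟨h, hh, hs, h0, heq⟩ := hΨ.exists_compactSupport_extension
  obtain ⟨C, hC, K, hK, hKs, hK0, hKC, hKE, hKeq⟩ := exists_homogeneous_hamiltonian hh hs h0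
  refine ⟨C, hC, K, hK, hKs, hK0, hKC, hKE, fun t ht σ h1 h2 => ?_⟩
  have hσ : 0 < ‖σ‖ := lt_trans (by positivity) h1
  have hσ' := norm_pos_iff.1 hσ
  have hn := hΨ.norm_snd σ hσ' t ht
  have h3 : (Ψ (σ, t)).1 = (Ψ (‖σ‖⁻¹ • σ, t)).1 := (hΨ.fst_smul _ (inv_pos.2 hσ) σ t).symm
  have h4 : ‖σ‖⁻¹ • (Ψ (σ, t)).2 = (Ψ (‖σ‖⁻¹ • σ, t)).2 :=
    (hΨ.snd_smul _ (inv_pos.2 hσ) σ t).symm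
  have h5 := hKeq t (Ψ (σ, t)).1 (Ψ (σ, t)).2 (by rwa [hn]) (by rwa [hn])
  rw [hn, h4, h3, Prod.mk.eta, heq _ (by rw [norm_smul, norm_inv, norm_norm, inv_mul_cancel₀ hσ.ne']) t ht,
    hΨ.conicHam_smul (inv_pos.2 hσ) hσ', mul_inv_cancel_left₀ hσ.ne'] at h5
  rw [← h5, ← h3]

end Homogenization

section Tangency

variable {V : Type*} [NormedAddCommGroup V] [InnerProductSpace ℝ V]

lemma mem_range_of_isotropic [FiniteDimensional ℝ V] (L : V →ₗ[ℝ] V × V)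
    (hinj : ∀ v, L v = 0 → v = 0) (hiso : ∀ v w, ⟪(L v).1, (L w).2⟫ = ⟪(L v).2, (L w).1⟫)
    {w : V × V} (hw : ∀ v, ⟪w.1, (L v).2⟫ = ⟪w.2, (L v).1⟫) : ∃ v, w = L v := by
  let P : V × V →ₗ[ℝ] V × V :=
    { toFun := fun p => L p.1 + ((L p.2).2, -(L p.2).1)
      map_add' := fun p q => by
        ext <;> simp <;> abel
      map_smul' := fun c p => by
        ext <;> simp }
  have hself : ∀ v v' u : V, (∀ v, ⟪(P (v', u)).1, (L v).2⟫ = ⟪(P (v', u)).2, (L v).1⟫) → u = 0 := by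
    intro _ v' u h
    have h1 := h u
    simp only [P, LinearMap.coe_mk, AddHom.coe_mk, Prod.fst_add, Prod.snd_add, inner_add_left,
      inner_neg_left, hiso] at h1
    have h2 := real_inner_self_nonneg (x := (L u).1)
    have h3 := real_inner_self_nonneg (x := (L u).2)
    refine hinj u (Prod.ext ?_ ?_)
    · exact inner_self_eq_zero (𝕜 := ℝ).1 (by linarith)
    · exact inner_self_eq_zero (𝕜 := ℝ).1 (by linarith)
  have hP : Function.Injective P := by
    rw [injective_iff_map_eq_zero]
    rintro ⟨v, u⟩ h
    have hu : u = 0 := hself 0 v u (by simp [h])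
    subst hu
    rw [Prod.mk_eq_zero]
    refine ⟨hinj v ?_, rfl⟩
    simpa [P, Prod.mk_zero_zero] using h
  obtain ⟨⟨v, u⟩, rfl⟩ := LinearMap.surjective_of_injective hP w
  have hu : u = 0 := hself 0 v u hw
  subst hu
  exact ⟨v, by simp [P, Prod.mk_zero_zero]⟩

lemma exists_hasFDerivAt_liouville {A : Type*} [NormedAddCommGroup A] [NormedSpace ℝ A]
    {f : A → V × V} {a : A} (hf : ContDiffAt ℝ 2 f a) (b : A) :
    ∃ M : A →L[ℝ] ℝ, HasFDerivAt (fun a' => ⟪(f a').2, (fderiv ℝ f a' b).1⟫) M a ∧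
      ∀ c, M c = ⟪(f a).2, (fderiv ℝ (fderiv ℝ f) a c b).1⟫ +
        ⟪(fderiv ℝ f a c).2, (fderiv ℝ f a b).1⟫ := by
  have h1 : HasFDerivAt f _ a := (hf.differentiableAt (by norm_num)).hasFDerivAt
  have h2 : HasFDerivAt (fderiv ℝ f) _ a :=
    ((hf.fderiv_right (m := 1) (by norm_num)).differentiableAt (by norm_num)).hasFDerivAt
  have h3 : HasFDerivAt (fun a' => (f a').2) _ a :=
    (ContinuousLinearMap.snd ℝ V V).hasFDerivAt.comp a h1
  have h4 : HasFDerivAt (fun a' => (fderiv ℝ f a' b).1) _ a :=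
    (ContinuousLinearMap.fst ℝ V V).hasFDerivAt.comp a (h2.clm_apply (hasFDerivAt_const b a))
  refine ⟨_, h3.inner ℝ h4, fun c => ?_⟩
  simp [fderivInnerCLM_apply]

namespace IsConicIsotopy

variable {Ψ : V × ℝ → V × V}

lemma symplectic_left (hΨ : IsConicIsotopy Ψ) {σ : V} (hσ : σ ≠ 0) {t : ℝ}
    (ht : t ∈ Icc (0 : ℝ) 1) (v w : V) :
    ⟪(Ψ (σ, t)).2, (fderiv ℝ (fderiv ℝ Ψ) (σ, t) (w, 0) (v, 0)).1⟫ +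
      ⟪(fderiv ℝ Ψ (σ, t) (w, 0)).2, (fderiv ℝ Ψ (σ, t) (v, 0)).1⟫ = 0 := by
  obtain ⟨M, hM, hMeq⟩ := exists_hasFDerivAt_liouville
    ((hΨ.smooth σ hσ t).of_le (by norm_num)) (v, 0)
  have h1 := hM.hasLineDerivAt (w, 0)
  rw [← hMeq]
  refine HasDerivAt.unique h1 ((hasDerivAt_const (0 : ℝ) (0 : ℝ)).congr_of_eventuallyEq ?_)
  have hc : ContinuousAt (fun s : ℝ => σ + s • w) 0 := by fun_prop
  filter_upwards [hc.eventually_ne (by simpa using hσ)] with s hs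
  simpa using hΨ.isotropic _ hs t ht v

lemma symplectic_right (hΨ : IsConicIsotopy Ψ) {σ : V} (hσ : σ ≠ 0) {t : ℝ}
    (ht : t ∈ Icc (0 : ℝ) 1) (v : V) :
    ⟪(Ψ (σ, t)).2, (fderiv ℝ (fderiv ℝ Ψ) (σ, t) (0, 1) (v, 0)).1⟫ +
      ⟪(fderiv ℝ Ψ (σ, t) (0, 1)).2, (fderiv ℝ Ψ (σ, t) (v, 0)).1⟫ = 0 := by
  obtain ⟨M, hM, hMeq⟩ := exists_hasFDerivAt_liouville
    ((hΨ.smooth σ hσ t).of_le (by norm_num)) (v, 0)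
  have h1 : HasDerivAt (fun s => ⟪(Ψ (σ, s)).2, (fderiv ℝ Ψ (σ, s) (v, 0)).1⟫) (M (0, 1)) t :=
    hM.comp_hasDerivAt t ((hasDerivAt_const t σ).prodMk (hasDerivAt_id t))
  rw [← hMeq]
  refine (uniqueDiffOn_Icc zero_lt_one t ht).eq_deriv _ h1.hasDerivWithinAt
    ((hasDerivWithinAt_const t _ (0 : ℝ)).congr (fun s hs => ?_) ?_)
  · exact hΨ.isotropic σ hσ s hs v
  · exact hΨ.isotropic σ hσ t ht v

lemma exists_hamField_eq [FiniteDimensional ℝ V] (hΨ : IsConicIsotopy Ψ) {K : ℝ × V × V → ℝ}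
    (hK : ContDiff ℝ 2 K) {σ : V} (hσ : σ ≠ 0) {t : ℝ} (ht : t ∈ Icc (0 : ℝ) 1)
    (heq : ∀ᶠ τ in nhds σ, K (t, Ψ (τ, t)) = conicHam Ψ (τ, t)) :
    ∃ v, hamField K (t, Ψ (σ, t)) = fderiv ℝ Ψ (σ, t) (v, 1) := by
  have hsm := (hΨ.smooth σ hσ t).of_le (show (2 : WithTop ℕ∞) ≤ 3 by norm_num)
  have hsymm : IsSymmSndFDerivAt ℝ Ψ (σ, t) := hsm.isSymmSndFDerivAt (by simp)
  obtain ⟨M, hM, hMeq⟩ := exists_hasFDerivAt_liouville hsm (0, 1)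
  have hham : ∀ v, ⟪(hamField K (t, Ψ (σ, t))).1, (fderiv ℝ Ψ (σ, t) (v, 0)).2⟫ -
      ⟪(hamField K (t, Ψ (σ, t))).2, (fderiv ℝ Ψ (σ, t) (v, 0)).1⟫ = M (v, 0) := by
    intro v
    have h1 : HasDerivAt (fun s : ℝ => conicHam Ψ (σ + s • v, t)) (M (v, 0)) 0 := by
      simpa [HasLineDerivAt, conicHam] using hM.hasLineDerivAt (v, 0)
    have h2 : HasDerivAt (fun s : ℝ => Ψ (σ + s • v, t)) (fderiv ℝ Ψ (σ, t) (v, 0)) 0 := by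
      simpa [HasLineDerivAt] using
        (hsm.differentiableAt (by norm_num)).hasFDerivAt.hasLineDerivAt (v, 0)
    have hKd : HasFDerivAt K (fderiv ℝ K (t, Ψ (σ, t))) (t, Ψ (σ + (0 : ℝ) • v, t)) := by
      simpa using (hK.differentiable (by norm_num) (t, Ψ (σ, t))).hasFDerivAt
    have h3 : HasDerivAt (fun s : ℝ => K (t, Ψ (σ + s • v, t)))
        (fderiv ℝ K (t, Ψ (σ, t)) (0, fderiv ℝ Ψ (σ, t) (v, 0))) 0 :=
      hKd.comp_hasDerivAt 0 ((hasDerivAt_const 0 t).prodMk h2)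
    have hc : ContinuousAt (fun s : ℝ => σ + s • v) 0 := by fun_prop
    have h4 : ∀ᶠ s : ℝ in nhds 0, K (t, Ψ (σ + s • v, t)) = conicHam Ψ (σ + s • v, t) :=
      hc.eventually (by simpa using heq)
    rw [← h3.unique (h1.congr_of_eventuallyEq h4), inner_hamField_fst, inner_hamField_snd,
      sub_neg_eq_add, ← map_add]
    simp
  let L : V →ₗ[ℝ] V × V := (fderiv ℝ Ψ (σ, t)).toLinearMap ∘ₗ LinearMap.inl ℝ V ℝ
  have hL : ∀ v, L v = fderiv ℝ Ψ (σ, t) (v, 0) := fun v => rfl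
  have key := mem_range_of_isotropic L (hΨ.immersive σ hσ t ht) (fun v w => ?_)
    (w := hamField K (t, Ψ (σ, t)) - fderiv ℝ Ψ (σ, t) (0, 1)) (fun v => ?_)
  · obtain ⟨v, hv⟩ := key
    refine ⟨v, ?_⟩
    rw [sub_eq_iff_eq_add, hL, ← map_add] at hv
    simpa using hv
  · have h1 := hΨ.symplectic_left hσ ht v w
    have h2 := hΨ.symplectic_left hσ ht w v
    rw [hsymm (v, 0) (w, 0)] at h2
    rw [hL, hL, real_inner_comm]
    linarith
  · have h1 := hham v
    have h2 := hΨ.symplectic_right hσ ht v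
    rw [hMeq, hsymm (v, 0) (0, 1)] at h1
    rw [hL, Prod.fst_sub, Prod.snd_sub, inner_sub_left, inner_sub_left]
    rw [real_inner_comm (fderiv ℝ Ψ (σ, t) (v, 0)).2 (fderiv ℝ Ψ (σ, t) (0, 1)).1]
    linarith

end IsConicIsotopy

end Tangency

section Propagation

variable {V : Type*} [NormedAddCommGroup V] [InnerProductSpace ℝ V]

namespace IsConicIsotopy

variable {Ψ : V × ℝ → V × V}

lemma fderiv_conicTrack (hΨ : IsConicIsotopy Ψ) {a : V × ℝ} (ha : a.1 ≠ 0) (b : V × ℝ) :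
    fderiv ℝ (conicTrack Ψ) a b = (b.2, fderiv ℝ Ψ a b) := by
  have h1 : HasFDerivAt (conicTrack Ψ) _ a := hasFDerivAt_snd.prodMk
    ((hΨ.smooth a.1 ha a.2).differentiableAt (by norm_num)).hasFDerivAt
  rw [h1.fderiv]
  rfl

variable [FiniteDimensional ℝ V]

/-- Near a point of the track, the velocity of the defect `p.2 - Ψ (q p)` along the Hamiltonian
flow is controlled by the defect itself. -/
lemma exists_defect_bound (hΨ : IsConicIsotopy Ψ) {K : ℝ × V × V → ℝ} (hK : ContDiff ℝ 2 K)
    {σ₀ : V} (hσ₀ : σ₀ ≠ 0) {t₀ : ℝ} (ht₀ : t₀ ∈ Icc (0 : ℝ) 1)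
    (heq : ∀ᶠ σ in nhds σ₀, ∀ t ∈ Icc (0 : ℝ) 1, K (t, Ψ (σ, t)) = conicHam Ψ (σ, t)) :
    ∃ q : ℝ × V × V → V × ℝ, (∀ p, (q p).2 = p.1) ∧ q (conicTrack Ψ (σ₀, t₀)) = (σ₀, t₀) ∧
      ∃ L : ℝ, ∀ᶠ p in nhds (conicTrack Ψ (σ₀, t₀)), (q p).1 ≠ 0 ∧
        DifferentiableAt ℝ (fun p => p.2 - Ψ (q p)) p ∧
        (p.1 ∈ Icc (0 : ℝ) 1 →
          ‖fderiv ℝ (fun p => p.2 - Ψ (q p)) p (1, hamField K p)‖ ≤ L * ‖p.2 - Ψ (q p)‖) := by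
  obtain ⟨G, hG, hGe⟩ := hΨ.exists_left_inverse_conicTrack hσ₀ ht₀
  set p₀ := conicTrack Ψ (σ₀, t₀) with hp₀
  let q : ℝ × V × V → V × ℝ := fun p => ((G p).1, p.1)
  have hq : ContDiffAt ℝ 3 q p₀ :=
    (contDiff_fst.contDiffAt.comp p₀ hG).prodMk contDiffAt_fst
  have hqe : ∀ᶠ a in nhds (σ₀, t₀), q (conicTrack Ψ a) = a := by
    filter_upwards [hGe] with a ha
    change ((G (conicTrack Ψ a)).1, a.2) = a
    rw [ha]
  have hq0 : q p₀ = (σ₀, t₀) := hqe.self_of_nhds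
  have hT : ContDiffAt ℝ 3 (conicTrack Ψ) (σ₀, t₀) := hΨ.contDiffAt_conicTrack hσ₀ t₀
  let E : ℝ × V × V → V × V := fun p => p.2 - Ψ (q p)
  have hE : ContDiffAt ℝ 3 E p₀ :=
    contDiffAt_snd.sub (ContDiffAt.comp p₀ (by rw [hq0]; exact hΨ.smooth σ₀ hσ₀ t₀) hq)
  have hEd : ∀ᶠ p in nhds p₀, DifferentiableAt ℝ E p :=
    (hE.eventually (by decide)).mono fun p hp => hp.differentiableAt (by norm_num)
  let R : ℝ × V × V → V × V := fun p => fderiv ℝ E p (1, hamField K p)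
  have hR : ContDiffAt ℝ 1 R p₀ := (hE.fderiv_right (by norm_num)).clm_apply
    (contDiffAt_const.prodMk (contDiff_hamField hK).contDiffAt)
  obtain ⟨L, N, hN, hL⟩ := hR.exists_lipschitzOnWith
  have hE0 : ∀ᶠ a in nhds (σ₀, t₀), E (conicTrack Ψ a) = 0 := by
    filter_upwards [hqe] with a ha
    change Ψ a - Ψ (q (conicTrack Ψ a)) = 0
    rw [ha, sub_self]
  have hne : ∀ᶠ a : V × ℝ in nhds (σ₀, t₀), a.1 ≠ 0 := continuous_fst.continuousAt.eventually_ne hσ₀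
  have heq' : ∀ᶠ a : V × ℝ in nhds (σ₀, t₀), ∀ᶠ σ in nhds a.1,
      ∀ t ∈ Icc (0 : ℝ) 1, K (t, Ψ (σ, t)) = conicHam Ψ (σ, t) :=
    (continuous_fst.tendsto (σ₀, t₀)).eventually heq.eventually_nhds
  have hR0 : ∀ᶠ a in nhds (σ₀, t₀), a.2 ∈ Icc (0 : ℝ) 1 → R (conicTrack Ψ a) = 0 := by
    filter_upwards [hE0.eventually_nhds, hT.continuousAt.eventually hEd, hne, heq']
      with a ha hda hna hea hta
    obtain ⟨v, hv⟩ := hΨ.exists_hamField_eq hK hna hta (hea.mono fun σ h => h _ hta)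
    have h1 : HasFDerivAt (fun a => E (conicTrack Ψ a)) _ a := hda.hasFDerivAt.comp a
      ((hΨ.contDiffAt_conicTrack hna a.2).differentiableAt (by norm_num)).hasFDerivAt
    have h2 := h1.unique ((hasFDerivAt_const (0 : V × V) a).congr_of_eventuallyEq ha)
    have h3 := DFunLike.congr_fun h2 (v, 1)
    rw [ContinuousLinearMap.comp_apply, hΨ.fderiv_conicTrack hna, ← hv] at h3
    exact h3
  refine ⟨q, fun p => rfl, hq0, L, ?_⟩
  have hqc : Filter.Tendsto q (nhds p₀) (nhds (σ₀, t₀)) := hq0 ▸ hq.continuousAt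
  have hTq' : ∀ᶠ p in nhds p₀, conicTrack Ψ (q p) ∈ N :=
    (hT.continuousAt.tendsto.comp hqc).eventually hN
  filter_upwards [hEd, hqc.eventually hne, hqc.eventually hR0, hN, hTq'] with p h1 h2 h3 h4 h5
  refine ⟨h2, h1, fun hp => ?_⟩
  have h6 := hL.norm_sub_le h4 h5
  rw [h3 hp, sub_zero] at h6
  have h7 : p - conicTrack Ψ (q p) = (0, E p) := Prod.ext (sub_self p.1) rfl
  rw [h7, Prod.norm_mk (0 : ℝ), norm_zero, max_eq_right (norm_nonneg _)] at h6
  exact h6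

lemma exists_extend_solution (hΨ : IsConicIsotopy Ψ) {K : ℝ × V × V → ℝ} (hK : ContDiff ℝ 2 K)
    {σ₀ : V} (hσ₀ : σ₀ ≠ 0) {t₀ : ℝ} (ht₀ : t₀ ∈ Ico (0 : ℝ) 1)
    (heq : ∀ᶠ σ in nhds σ₀, ∀ t ∈ Icc (0 : ℝ) 1, K (t, Ψ (σ, t)) = conicHam Ψ (σ, t))
    {z : ℝ → V × V}
    (hz : ∀ t ∈ Icc (0 : ℝ) 1, HasDerivWithinAt z (hamField K (t, z t)) (Icc 0 1) t)
    (hz₀ : z t₀ = Ψ (σ₀, t₀)) :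
    ∃ u, t₀ < u ∧ u ≤ 1 ∧ ∀ t ∈ Icc t₀ u, ∃ σ ≠ 0, z t = Ψ (σ, t) := by
  obtain ⟨q, hq, hq0, L, hL⟩ := hΨ.exists_defect_bound hK hσ₀ ⟨ht₀.1, ht₀.2.le⟩ heq
  have hp₀ : (t₀, z t₀) = conicTrack Ψ (σ₀, t₀) := by rw [hz₀]; rfl
  have hsub : Icc t₀ 1 ⊆ Icc (0 : ℝ) 1 := Icc_subset_Icc_left ht₀.1
  have hzc : ContinuousWithinAt (fun t => (t, z t)) (Icc t₀ 1) t₀ :=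
    continuousWithinAt_id.prodMk
      ((hz t₀ ⟨ht₀.1, ht₀.2.le⟩).continuousWithinAt.mono hsub)
  rw [← hp₀] at hL
  have hgood := hzc.eventually hL
  rw [nhdsWithin_Icc_eq_nhdsGE ht₀.2] at hgood
  obtain ⟨u, hu, hus⟩ := mem_nhdsGE_iff_exists_Icc_subset.1
    (Filter.inter_mem hgood (Icc_mem_nhdsGE ht₀.2))
  have hu1 : u ≤ 1 := (hus (right_mem_Icc.2 hu.le)).2.2
  refine ⟨u, hu, hu1, fun t ht => ?_⟩
  have hd : ∀ t ∈ Icc t₀ u, HasDerivWithinAt (fun t => (t, z t).2 - Ψ (q (t, z t)))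
      (fderiv ℝ (fun p => p.2 - Ψ (q p)) (t, z t) (1, hamField K (t, z t))) (Icc 0 1) t := by
    intro t ht
    have htI := hsub (hus ht).2
    exact (hus ht).1.2.1.hasFDerivAt.comp_hasDerivWithinAt t
      ((hasDerivWithinAt_id t _).prodMk (hz t htI))
  have hzero := eq_zero_of_abs_deriv_le_mul_abs_self_of_eq_zero_right
    (f := fun t => (t, z t).2 - Ψ (q (t, z t))) (K := L)
    (fun t ht => (hd t ht).continuousWithinAt.mono fun s hs => hsub (hus hs).2)
    (fun t ht => (hd t ⟨ht.1, ht.2.le⟩).mono_of_mem_nhdsWithin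
      (Filter.mem_of_superset (Icc_mem_nhdsGE (ht.2.trans_le hu1))
        (Icc_subset_Icc_left (ht₀.1.trans ht.1))))
    (by simp only [hp₀, hq0]; exact sub_eq_zero.2 (congrArg Prod.snd hp₀))
    (fun t ht => (hus ⟨ht.1, ht.2.le⟩).1.2.2 (hsub (hus ⟨ht.1, ht.2.le⟩).2)) t ht
  refine ⟨(q (t, z t)).1, (hus ht).1.1, ?_⟩
  have h1 : q (t, z t) = ((q (t, z t)).1, t) := Prod.ext rfl (hq _)
  rw [← h1]
  exact sub_eq_zero.1 hzero

lemma exists_eq_of_solution (hΨ : IsConicIsotopy Ψ) {K : ℝ × V × V → ℝ} (hK : ContDiff ℝ 2 K)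
    {a b : ℝ} (ha : 0 < a)
    (heq : ∀ t ∈ Icc (0 : ℝ) 1, ∀ σ, a < ‖σ‖ → ‖σ‖ < b → K (t, Ψ (σ, t)) = conicHam Ψ (σ, t))
    {z : ℝ → V × V}
    (hz : ∀ t ∈ Icc (0 : ℝ) 1, HasDerivWithinAt z (hamField K (t, z t)) (Icc 0 1) t)
    (hzn : ∀ t ∈ Icc (0 : ℝ) 1, a < ‖(z t).2‖ ∧ ‖(z t).2‖ < b) {σ₀ : V} (hσ₀ : σ₀ ≠ 0)
    (hz₀ : z 0 = Ψ (σ₀, 0)) :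
    ∀ t ∈ Icc (0 : ℝ) 1, ∃ σ ≠ 0, z t = Ψ (σ, t) := by
  have hzc : ContinuousOn z (Icc 0 1) := fun t ht => (hz t ht).continuousWithinAt
  have hnorm : ∀ t ∈ Icc (0 : ℝ) 1, ∀ σ ≠ 0, z t = Ψ (σ, t) → a < ‖σ‖ ∧ ‖σ‖ < b := by
    intro t ht σ hσ h
    rw [← hΨ.norm_snd σ hσ t ht, ← h]
    exact hzn t ht
  let A : Set (V × ℝ) := {σ : V | a ≤ ‖σ‖ ∧ ‖σ‖ ≤ b} ×ˢ Icc (0 : ℝ) 1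
  have hA : IsCompact A := by
    refine IsCompact.prod ?_ isCompact_Icc
    refine (isCompact_closedBall (0 : V) b).of_isClosed_subset ?_ fun σ hσ => by simpa using hσ.2
    exact (isClosed_le continuous_const continuous_norm).inter
      (isClosed_le continuous_norm continuous_const)
  have hS : IsClosed ({t | ∃ σ ≠ 0, z t = Ψ (σ, t)} ∩ Icc (0 : ℝ) 1) := by
    have hcont : ContinuousOn (fun p : V × ℝ => z p.2 - Ψ p) A := by
      refine (hzc.comp continuousOn_snd fun p hp => hp.2).sub fun p hp => ?_
      have hp0 : p.1 ≠ 0 := norm_pos_iff.1 (ha.trans_le hp.1.1)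
      exact (hΨ.smooth p.1 hp0 p.2).continuousAt.continuousWithinAt
    have hcl : IsClosed (A ∩ (fun p : V × ℝ => z p.2 - Ψ p) ⁻¹' {0}) :=
      hcont.preimage_isClosed_of_isClosed hA.isClosed isClosed_singleton
    have himg := ((hA.of_isClosed_subset hcl inter_subset_left).image continuous_snd).isClosed
    convert himg using 1
    ext t
    constructor
    · rintro ⟨⟨σ, hσ, h⟩, ht⟩
      have hn := hnorm t ht σ hσ h
      exact ⟨(σ, t), ⟨⟨⟨hn.1.le, hn.2.le⟩, ht⟩, sub_eq_zero.2 h⟩, rfl⟩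
    · rintro ⟨⟨σ, s⟩, ⟨⟨hσ, hs⟩, h⟩, rfl⟩
      exact ⟨⟨σ, norm_pos_iff.1 (ha.trans_le hσ.1), sub_eq_zero.1 h⟩, hs⟩
  refine hS.Icc_subset_of_forall_exists_gt ⟨σ₀, hσ₀, hz₀⟩ ?_
  rintro t ⟨⟨σ, hσ, h⟩, ht⟩ y hy
  have hn := hnorm t ⟨ht.1, ht.2.le⟩ σ hσ h
  have hev : ∀ᶠ τ in nhds σ, ∀ t ∈ Icc (0 : ℝ) 1, K (t, Ψ (τ, t)) = conicHam Ψ (τ, t) := by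
    filter_upwards [continuous_norm.continuousAt.eventually (lt_mem_nhds hn.1),
      continuous_norm.continuousAt.eventually (gt_mem_nhds hn.2)] with τ h1 h2 s hs
    exact heq s hs τ h1 h2
  obtain ⟨u, hu, -, hext⟩ := hΨ.exists_extend_solution hK hσ ht hev hz h
  refine ⟨min u y, hext _ ⟨(lt_min hu hy).le, min_le_left _ _⟩, lt_min hu hy, min_le_right _ _⟩

/-- A positive conic isotopy starting at the cotangent fibre over `0` reaches every codirection at
a point with nonnegative pairing. -/
theorem exists_nonneg_pairing (hΨ : IsConicIsotopy Ψ) (hΨ0 : ∀ σ ≠ 0, Ψ (σ, 0) = (0, σ)) {q₀ : V}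
    (hq₀ : ‖q₀‖ = 1) :
    ∃ s, ‖s‖ = 1 ∧ (Ψ (s, 1)).2 = q₀ ∧ 0 ≤ ⟪(Ψ (s, 1)).1, (Ψ (s, 1)).2⟫ := by
  obtain ⟨C, hC, K, hK, hKs, hK0, hKC, hKE, hKeq⟩ := hΨ.exists_hamiltonian
  have hone : (1 : ℝ) ∈ Icc (0 : ℝ) 1 := right_mem_Icc.2 zero_le_one
  have happrox : ∀ ε : ℝ, 0 < ε → ∃ σ ∈ {σ : V | Real.exp (-C) / 4 ≤ ‖σ‖ ∧ ‖σ‖ ≤ 2 * Real.exp C},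
      ‖(Ψ (σ, 1)).2 - q₀‖ ≤ ε ∧ -ε ≤ ⟪(Ψ (σ, 1)).1, (Ψ (σ, 1)).2⟫ := by
    intro ε hε
    obtain ⟨z, hz0, hz, hzn, h1, h2⟩ :=
      exists_hamiltonian_trajectory hK hKs hK0 hC hKC hKE hq₀ hε
    have hz00 : (z 0).2 ≠ 0 := norm_pos_iff.1
      (lt_trans (by positivity) (hzn 0 (left_mem_Icc.2 zero_le_one)).1)
    obtain ⟨σ, hσ, h⟩ := hΨ.exists_eq_of_solution hK (by positivity) hKeq hz hzn hz00
      (by rw [hΨ0 _ hz00, ← hz0]) 1 hone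
    have hn := hzn 1 hone
    rw [h] at hn h1 h2
    rw [hΨ.norm_snd σ hσ 1 hone] at hn
    exact ⟨σ, ⟨hn.1.le, hn.2.le⟩, h1, h2⟩
  have hcpt : IsCompact {σ : V | Real.exp (-C) / 4 ≤ ‖σ‖ ∧ ‖σ‖ ≤ 2 * Real.exp C} := by
    refine (isCompact_closedBall (0 : V) (2 * Real.exp C)).of_isClosed_subset ?_
      fun σ hσ => by simpa using hσ.2
    exact (isClosed_le continuous_const continuous_norm).inter
      (isClosed_le continuous_norm continuous_const)
  choose! σ hσmem hσ1 hσ2 using fun n : ℕ => happrox (1 / ((n : ℝ) + 1)) (by positivity)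
  obtain ⟨s, hs, φ, hφ, hlim⟩ := hcpt.tendsto_subseq hσmem
  have hs0 : s ≠ 0 := norm_pos_iff.1 (lt_of_lt_of_le (by positivity) hs.1)
  have hΨs : Filter.Tendsto (fun n => Ψ (σ (φ n), 1)) Filter.atTop (nhds (Ψ (s, 1))) :=
    (hΨ.smooth s hs0 1).continuousAt.tendsto.comp (hlim.prodMk_nhds tendsto_const_nhds)
  have heps : Filter.Tendsto (fun n => 1 / ((φ n : ℝ) + 1)) Filter.atTop (nhds 0) :=
    tendsto_one_div_add_atTop_nhds_zero_nat.comp hφ.tendsto_atTop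
  have h1 : ‖(Ψ (s, 1)).2 - q₀‖ ≤ 0 :=
    le_of_tendsto_of_tendsto' (((continuous_snd.tendsto _).comp hΨs).sub_const q₀).norm heps
      fun n => hσ1 (φ n)
  have h2 : -(0 : ℝ) ≤ ⟪(Ψ (s, 1)).1, (Ψ (s, 1)).2⟫ :=
    le_of_tendsto_of_tendsto' heps.neg
      (((continuous_fst.tendsto _).comp hΨs).inner ((continuous_snd.tendsto _).comp hΨs))
      fun n => hσ2 (φ n)
  have h3 : (Ψ (s, 1)).2 = q₀ := sub_eq_zero.1 (norm_le_zero_iff.1 h1)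
  refine ⟨s, ?_, h3, by simpa using h2⟩
  rw [← hΨ.norm_snd s hs0 1 hone, h3, hq₀]

end IsConicIsotopy

end Propagation

section Polar

variable {V : Type*} [NormedAddCommGroup V] [InnerProductSpace ℝ V]

lemma exists_hasFDerivAt_norm {σ : V} (hσ : σ ≠ 0) :
    ∃ M : V →L[ℝ] ℝ, HasFDerivAt (fun x : V => ‖x‖) M σ ∧ ∀ v, ‖σ‖ * M v = ⟪σ, v⟫ := by
  have h : DifferentiableAt ℝ (fun x : V => ‖x‖) σ := differentiableAt_id.norm ℝ hσ
  refine ⟨_, h.hasFDerivAt, fun v => ?_⟩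
  have h1 := (h.hasFDerivAt.pow 2).unique (hasStrictFDerivAt_norm_sq σ).hasFDerivAt
  have h2 := DFunLike.congr_fun h1 v
  simp at h2
  linarith

lemma exists_hasFDerivAt_normalize {σ : V} (hσ : σ ≠ 0) :
    ∃ M : V →L[ℝ] V, HasFDerivAt (fun x : V => ‖x‖⁻¹ • x) M σ ∧
      (∀ v, ⟪M v, ‖σ‖⁻¹ • σ⟫ = 0) ∧ ∀ v, ⟪σ, v⟫ = 0 → M v = ‖σ‖⁻¹ • v := by
  obtain ⟨M, hM, hMeq⟩ := exists_hasFDerivAt_norm hσ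
  have hn : ‖σ‖ ≠ 0 := norm_ne_zero_iff.2 hσ
  have hMv : ∀ v, M v = ‖σ‖⁻¹ * ⟪σ, v⟫ := fun v => by rw [← hMeq, inv_mul_cancel_left₀ hn]
  refine ⟨_, ((hasDerivAt_inv hn).comp_hasFDerivAt σ hM).smul (hasFDerivAt_id σ),
    fun v => ?_, fun v hv => ?_⟩
  · simp only [Function.comp_apply, add_apply, FunLike.coe_smul, Pi.smul_apply,
      ContinuousLinearMap.smulRight_apply, ContinuousLinearMap.id_apply, hMv, inner_add_left,
      real_inner_smul_left, real_inner_smul_right, real_inner_self_eq_norm_sq, smul_eq_mul,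
      real_inner_comm σ v]
    field_simp
    ring
  · simp [hMv, hv]

/-- A function which is constant on `{σ | σ ≠ 0} × [0, 1]` has zero derivative there, including at
the end points. -/
lemma fderiv_eq_zero_of_const {g : V × ℝ → ℝ} {g' : V × ℝ →L[ℝ] ℝ} {c : ℝ} {σ : V} (hσ : σ ≠ 0)
    {t : ℝ} (ht : t ∈ Icc (0 : ℝ) 1) (hg : HasFDerivAt g g' (σ, t))
    (hc : ∀ τ ≠ 0, ∀ s ∈ Icc (0 : ℝ) 1, g (τ, s) = c) : g' = 0 := by
  have hu : UniqueDiffWithinAt ℝ ({0}ᶜ ×ˢ Icc (0 : ℝ) 1 : Set (V × ℝ)) (σ, t) :=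
    (isOpen_compl_singleton.uniqueDiffWithinAt hσ).prod (uniqueDiffOn_Icc zero_lt_one t ht)
  exact hu.eq hg.hasFDerivWithinAt ((hasFDerivWithinAt_const c _ _).congr
    (fun p hp => hc p.1 hp.1 p.2 hp.2) (hc σ hσ t ht))

/-- A non-negative isotopy of Legendrian spheres in the `1`-jet space of the unit sphere, extended
to `V \ {0}` as a function homogeneous of degree `0`. -/
structure IsRadialJetIsotopy (J : V × ℝ → V × V × ℝ) : Prop where
  smooth : ∀ σ ≠ 0, ∀ t, ContDiffAt ℝ 3 J (σ, t)
  smul : ∀ c : ℝ, 0 < c → ∀ σ t, J (c • σ, t) = J (σ, t)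
  norm_fst : ∀ σ ≠ 0, ∀ t ∈ Icc (0 : ℝ) 1, ‖(J (σ, t)).1‖ = 1
  inner_eq_zero : ∀ σ ≠ 0, ∀ t ∈ Icc (0 : ℝ) 1, ⟪(J (σ, t)).2.1, (J (σ, t)).1⟫ = 0
  legendrian : ∀ σ ≠ 0, ∀ t ∈ Icc (0 : ℝ) 1, ∀ v,
    (fderiv ℝ J (σ, t) (v, 0)).2.2 = ⟪(J (σ, t)).2.1, (fderiv ℝ J (σ, t) (v, 0)).1⟫
  immersive : ∀ σ ≠ 0, ∀ t ∈ Icc (0 : ℝ) 1, ∀ v, ⟪σ, v⟫ = 0 → fderiv ℝ J (σ, t) (v, 0) = 0 → v = 0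
  nonneg : ∀ σ ≠ 0, ∀ t ∈ Icc (0 : ℝ) 1,
    0 ≤ (fderiv ℝ J (σ, t) (0, 1)).2.2 - ⟪(J (σ, t)).2.1, (fderiv ℝ J (σ, t) (0, 1)).1⟫
  inj : ∀ t ∈ Icc (0 : ℝ) 1, ∀ σ ≠ 0, ∀ τ ≠ 0, J (σ, t) = J (τ, t) → ‖σ‖⁻¹ • σ = ‖τ‖⁻¹ • τ

/-- The conic isotopy associated with a Legendrian isotopy, sped up by `η`: the jet `(q, p, u)`
goes to the point `(u + η t) q + p` with codirection `q`. -/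
def conicOfJet (η : ℝ) (J : V × ℝ → V × V × ℝ) (a : V × ℝ) : V × V :=
  (((J a).2.2 + η * a.2) • (J a).1 + (J a).2.1, ‖a.1‖ • (J a).1)

namespace IsRadialJetIsotopy

variable {J : V × ℝ → V × V × ℝ}

lemma hasFDerivAt (hJ : IsRadialJetIsotopy J) {σ : V} (hσ : σ ≠ 0) (t : ℝ) :
    HasFDerivAt J (fderiv ℝ J (σ, t)) (σ, t) :=
  ((hJ.smooth σ hσ t).differentiableAt (by norm_num)).hasFDerivAt

lemma hasFDerivAt_fst (hJ : IsRadialJetIsotopy J) {σ : V} (hσ : σ ≠ 0) (t : ℝ) :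
    HasFDerivAt (fun a => (J a).1)
      ((ContinuousLinearMap.fst ℝ V (V × ℝ)).comp (fderiv ℝ J (σ, t))) (σ, t) :=
  (ContinuousLinearMap.fst ℝ V (V × ℝ)).hasFDerivAt.comp _ (hJ.hasFDerivAt hσ t)

lemma hasFDerivAt_snd_fst (hJ : IsRadialJetIsotopy J) {σ : V} (hσ : σ ≠ 0) (t : ℝ) :
    HasFDerivAt (fun a => (J a).2.1) (((ContinuousLinearMap.fst ℝ V ℝ).comp
      (ContinuousLinearMap.snd ℝ V (V × ℝ))).comp (fderiv ℝ J (σ, t))) (σ, t) :=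
  ((ContinuousLinearMap.fst ℝ V ℝ).comp
    (ContinuousLinearMap.snd ℝ V (V × ℝ))).hasFDerivAt.comp _ (hJ.hasFDerivAt hσ t)

lemma hasFDerivAt_snd_snd (hJ : IsRadialJetIsotopy J) {σ : V} (hσ : σ ≠ 0) (t : ℝ) :
    HasFDerivAt (fun a => (J a).2.2) (((ContinuousLinearMap.snd ℝ V ℝ).comp
      (ContinuousLinearMap.snd ℝ V (V × ℝ))).comp (fderiv ℝ J (σ, t))) (σ, t) :=
  ((ContinuousLinearMap.snd ℝ V ℝ).comp
    (ContinuousLinearMap.snd ℝ V (V × ℝ))).hasFDerivAt.comp _ (hJ.hasFDerivAt hσ t)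

lemma inner_fderiv_fst (hJ : IsRadialJetIsotopy J) {σ : V} (hσ : σ ≠ 0) {t : ℝ}
    (ht : t ∈ Icc (0 : ℝ) 1) (b : V × ℝ) : ⟪(J (σ, t)).1, (fderiv ℝ J (σ, t) b).1⟫ = 0 := by
  have h1 := (hJ.hasFDerivAt_fst hσ t).inner ℝ (hJ.hasFDerivAt_fst hσ t)
  have h2 := fderiv_eq_zero_of_const (c := 1) hσ ht h1 fun τ hτ s hs => by
    rw [real_inner_self_eq_norm_sq, hJ.norm_fst τ hτ s hs, one_pow]
  have h3 := DFunLike.congr_fun h2 b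
  simp [fderivInnerCLM_apply] at h3
  rw [real_inner_comm (J (σ, t)).1 (fderiv ℝ J (σ, t) b).1] at h3
  linarith

lemma inner_fderiv_snd_fst (hJ : IsRadialJetIsotopy J) {σ : V} (hσ : σ ≠ 0) {t : ℝ}
    (ht : t ∈ Icc (0 : ℝ) 1) (b : V × ℝ) :
    ⟪(J (σ, t)).1, (fderiv ℝ J (σ, t) b).2.1⟫ = -⟪(J (σ, t)).2.1, (fderiv ℝ J (σ, t) b).1⟫ := by
  have h1 := (hJ.hasFDerivAt_snd_fst hσ t).inner ℝ (hJ.hasFDerivAt_fst hσ t)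
  have h2 := fderiv_eq_zero_of_const (c := 0) hσ ht h1 hJ.inner_eq_zero
  have h3 := DFunLike.congr_fun h2 b
  simp [fderivInnerCLM_apply] at h3
  rw [real_inner_comm]
  linarith

lemma fderiv_conicOfJet_fst (hJ : IsRadialJetIsotopy J) (η : ℝ) {σ : V} (hσ : σ ≠ 0) (t : ℝ)
    (b : V × ℝ) (hd : DifferentiableAt ℝ (conicOfJet η J) (σ, t)) :
    (fderiv ℝ (conicOfJet η J) (σ, t) b).1 =
      ((fderiv ℝ J (σ, t) b).2.2 + η * b.2) • (J (σ, t)).1 +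
        ((J (σ, t)).2.2 + η * t) • (fderiv ℝ J (σ, t) b).1 + (fderiv ℝ J (σ, t) b).2.1 := by
  have h1 : HasFDerivAt (fun a => (conicOfJet η J a).1) _ (σ, t) :=
    (ContinuousLinearMap.fst ℝ V V).hasFDerivAt.comp _ hd.hasFDerivAt
  have h2 : HasFDerivAt (fun a => (conicOfJet η J a).1) _ (σ, t) :=
    (((hJ.hasFDerivAt_snd_snd hσ t).add (hasFDerivAt_snd.const_mul η)).smul
      (hJ.hasFDerivAt_fst hσ t)).add (hJ.hasFDerivAt_snd_fst hσ t)
  have h3 := DFunLike.congr_fun (h1.unique h2) b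
  simp at h3
  rw [h3]
  abel

lemma exists_fderiv_conicOfJet_snd (hJ : IsRadialJetIsotopy J) (η : ℝ) {σ : V} (hσ : σ ≠ 0) (t : ℝ)
    (b : V × ℝ) (hd : DifferentiableAt ℝ (conicOfJet η J) (σ, t)) :
    ∃ c : ℝ, ‖σ‖ * c = ⟪σ, b.1⟫ ∧ (fderiv ℝ (conicOfJet η J) (σ, t) b).2 =
      c • (J (σ, t)).1 + ‖σ‖ • (fderiv ℝ J (σ, t) b).1 := by
  obtain ⟨M, hM, hMeq⟩ := exists_hasFDerivAt_norm hσ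
  have h1 : HasFDerivAt (fun a => (conicOfJet η J a).2) _ (σ, t) :=
    (ContinuousLinearMap.snd ℝ V V).hasFDerivAt.comp _ hd.hasFDerivAt
  have hM' : HasFDerivAt (fun a : V × ℝ => ‖a.1‖) (M.comp (ContinuousLinearMap.fst ℝ V ℝ)) (σ, t) :=
    HasFDerivAt.comp (σ, t) hM (ContinuousLinearMap.fst ℝ V ℝ).hasFDerivAt
  have h2 : HasFDerivAt (fun a => (conicOfJet η J a).2) _ (σ, t) :=
    hM'.smul (hJ.hasFDerivAt_fst hσ t)
  have h3 := DFunLike.congr_fun (h1.unique h2) b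
  refine ⟨M b.1, hMeq _, ?_⟩
  simp at h3
  rw [h3, add_comm]

lemma isConicIsotopy (hJ : IsRadialJetIsotopy J) {η : ℝ} (hη : 0 < η) :
    IsConicIsotopy (conicOfJet η J) := by
  have hsm : ∀ σ ≠ 0, ∀ t, ContDiffAt ℝ 3 (conicOfJet η J) (σ, t) := by
    intro σ hσ t
    have h := hJ.smooth σ hσ t
    have hq : ContDiffAt ℝ 3 (fun a => (J a).1) (σ, t) := contDiff_fst.contDiffAt.comp _ h
    have hp : ContDiffAt ℝ 3 (fun a => (J a).2.1) (σ, t) :=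
      (contDiff_fst.comp contDiff_snd).contDiffAt.comp _ h
    have hu : ContDiffAt ℝ 3 (fun a => (J a).2.2) (σ, t) :=
      (contDiff_snd.comp contDiff_snd).contDiffAt.comp _ h
    have hn : ContDiffAt ℝ 3 (fun a : V × ℝ => ‖a.1‖) (σ, t) := contDiffAt_fst.norm ℝ hσ
    exact (((hu.add (contDiffAt_const.mul contDiffAt_snd)).smul hq).add hp).prodMk (hn.smul hq)
  have hd : ∀ σ ≠ 0, ∀ t, DifferentiableAt ℝ (conicOfJet η J) (σ, t) := fun σ hσ t =>
    (hsm σ hσ t).differentiableAt (by norm_num)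
  have hqq : ∀ σ ≠ 0, ∀ t ∈ Icc (0 : ℝ) 1, ⟪(J (σ, t)).1, (J (σ, t)).1⟫ = 1 :=
    fun σ hσ t ht => by rw [real_inner_self_eq_norm_sq, hJ.norm_fst σ hσ t ht, one_pow]
  have hpair : ∀ σ ≠ 0, ∀ t ∈ Icc (0 : ℝ) 1, ∀ b,
      ⟪(J (σ, t)).1, (fderiv ℝ (conicOfJet η J) (σ, t) b).1⟫ =
        (fderiv ℝ J (σ, t) b).2.2 + η * b.2 - ⟪(J (σ, t)).2.1, (fderiv ℝ J (σ, t) b).1⟫ := by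
    intro σ hσ t ht b
    rw [hJ.fderiv_conicOfJet_fst η hσ t b (hd σ hσ t), inner_add_right, inner_add_right,
      real_inner_smul_right, real_inner_smul_right, hqq σ hσ t ht, hJ.inner_fderiv_fst hσ ht,
      hJ.inner_fderiv_snd_fst hσ ht]
    ring
  refine ⟨hsm, fun c hc σ t => ?_, fun c hc σ t => ?_, fun σ hσ t ht => ?_, fun σ hσ t ht v => ?_,
    fun σ hσ t ht v hv => ?_, fun t ht σ hσ τ hτ h => ?_, fun σ hσ t ht => ?_⟩
  · simp only [conicOfJet, hJ.smul c hc]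
  · simp only [conicOfJet, hJ.smul c hc, norm_smul, Real.norm_of_nonneg hc.le, smul_smul]
  · simp only [conicOfJet, norm_smul, hJ.norm_fst σ hσ t ht, norm_norm, mul_one]
  · have h := hpair σ hσ t ht (v, 0)
    change ⟪‖σ‖ • (J (σ, t)).1, _⟫ = 0
    rw [real_inner_smul_left, h, hJ.legendrian σ hσ t ht]
    ring
  · obtain ⟨c, hc, hceq⟩ := hJ.exists_fderiv_conicOfJet_snd η hσ t (v, 0) (hd σ hσ t)
    have h1 := hJ.fderiv_conicOfJet_fst η hσ t (v, 0) (hd σ hσ t)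
    rw [hv] at hceq h1
    have hc0 : c = 0 := by
      have h2 := congrArg (fun x => ⟪(J (σ, t)).1, x⟫) hceq
      simp only [inner_add_right, real_inner_smul_right, hqq σ hσ t ht,
        hJ.inner_fderiv_fst hσ ht, Prod.snd_zero, inner_zero_right] at h2
      linarith
    have hq0 : (fderiv ℝ J (σ, t) (v, 0)).1 = 0 := by
      simpa [hc0, hσ] using hceq.symm
    have hu0 : (fderiv ℝ J (σ, t) (v, 0)).2.2 = 0 := by
      rw [hJ.legendrian σ hσ t ht, hq0, inner_zero_right]
    have hp0 : (fderiv ℝ J (σ, t) (v, 0)).2.1 = 0 := by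
      simpa [hq0, hu0] using h1.symm
    exact hJ.immersive σ hσ t ht v (by rw [← hc, hc0, mul_zero])
      (Prod.ext hq0 (Prod.ext hp0 hu0))
  · obtain ⟨hx, hy⟩ := Prod.ext_iff.1 h
    simp only [conicOfJet] at hx hy
    have hn : ‖σ‖ = ‖τ‖ := by
      have h1 := congrArg norm hy
      simpa [norm_smul, hJ.norm_fst σ hσ t ht, hJ.norm_fst τ hτ t ht] using h1
    have hq : (J (σ, t)).1 = (J (τ, t)).1 := by
      rw [← hn] at hy
      exact smul_right_injective V (norm_ne_zero_iff.2 hσ) hy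
    have hu : (J (σ, t)).2.2 = (J (τ, t)).2.2 := by
      have h1 := congrArg (fun x => ⟪x, (J (σ, t)).1⟫) hx
      simp only [inner_add_left, real_inner_smul_left, hJ.inner_eq_zero σ hσ t ht] at h1
      rw [hq, hJ.inner_eq_zero τ hτ t ht, hqq τ hτ t ht] at h1
      linarith
    have hp : (J (σ, t)).2.1 = (J (τ, t)).2.1 := by
      rw [hq, hu] at hx
      exact add_left_cancel hx
    have h2 := hJ.inj t ht σ hσ τ hτ (Prod.ext hq (Prod.ext hp hu))
    rw [hn] at h2
    exact smul_right_injective V (inv_ne_zero (norm_ne_zero_iff.2 hτ)) h2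
  · have h := hpair σ hσ t ht (0, 1)
    have h1 := hJ.nonneg σ hσ t ht
    have h2 := norm_pos_iff.2 hσ
    change 0 < ⟪‖σ‖ • (J (σ, t)).1, _⟫
    rw [real_inner_smul_left, h]
    refine mul_pos h2 ?_
    simp only [mul_one]
    linarith

/-- The value of a non-negative Legendrian isotopy starting at the zero section over a point of
the sphere is somewhere at least `-η`. -/
lemma exists_neg_le [FiniteDimensional ℝ V] (hJ : IsRadialJetIsotopy J)
    (hJ0 : ∀ σ ≠ 0, J (σ, 0) = (‖σ‖⁻¹ • σ, 0, 0)) {q₀ : V} (hq₀ : ‖q₀‖ = 1) {η : ℝ} (hη : 0 < η) :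
    ∃ s, ‖s‖ = 1 ∧ (J (s, 1)).1 = q₀ ∧ -η ≤ (J (s, 1)).2.2 := by
  have h0 : ∀ σ ≠ 0, conicOfJet η J (σ, 0) = (0, σ) := fun σ hσ => by
    simp [conicOfJet, hJ0 σ hσ, hσ]
  obtain ⟨s, hs, hs2, hs3⟩ := (hJ.isConicIsotopy hη).exists_nonneg_pairing h0 hq₀
  have hs0 : s ≠ 0 := norm_ne_zero_iff.1 (hs.symm ▸ one_ne_zero)
  have hone : (1 : ℝ) ∈ Icc (0 : ℝ) 1 := right_mem_Icc.2 zero_le_one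
  simp only [conicOfJet, hs, one_smul] at hs2 hs3
  rw [inner_add_left, real_inner_smul_left, hJ.inner_eq_zero s hs0 1 hone,
    real_inner_self_eq_norm_sq, hJ.norm_fst s hs0 1 hone] at hs3
  exact ⟨s, hs, hs2, by linarith⟩

end IsRadialJetIsotopy

end Polar

section Jet

variable {m : ℕ} {F : EuclideanSpace ℝ (Fin m) × ℝ → JetSp m}

lemma normalize_mem_sph {σ : EuclideanSpace ℝ (Fin m)} (hσ : σ ≠ 0) : ‖σ‖⁻¹ • σ ∈ sph m :=
  mem_sphere_zero_iff_norm.2 (norm_smul_inv_norm (𝕜 := ℝ) hσ)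

/-- The extension of an isotopy of spheres which is homogeneous of degree `0`. -/
def radialExtension (F : EuclideanSpace ℝ (Fin m) × ℝ → JetSp m)
    (a : EuclideanSpace ℝ (Fin m) × ℝ) : JetSp m :=
  F (‖a.1‖⁻¹ • a.1, a.2)

lemma IsLegIsotopyJet.hasFDerivAt (hF : IsLegIsotopyJet m F) (a : EuclideanSpace ℝ (Fin m) × ℝ) :
    HasFDerivAt F (fderiv ℝ F a) a :=
  (hF.smooth.differentiable (by simp) a).hasFDerivAt

lemma IsLegIsotopyJet.fderiv_slice (hF : IsLegIsotopyJet m F) (s v : EuclideanSpace ℝ (Fin m))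
    (t : ℝ) : fderiv ℝ (fun s' => F (s', t)) s v = fderiv ℝ F (s, t) (v, 0) := by
  have h : HasFDerivAt (fun s' => F (s', t)) _ s :=
    HasFDerivAt.comp s (hF.hasFDerivAt (s, t)) (hasFDerivAt_prodMk_left s t)
  rw [h.fderiv]
  simp

lemma IsLegIsotopyJet.hasDerivAt_time (hF : IsLegIsotopyJet m F) (s : EuclideanSpace ℝ (Fin m))
    (t : ℝ) : HasDerivAt (fun t' => F (s, t')) (fderiv ℝ F (s, t) (0, 1)) t := by
  have h : HasFDerivAt (fun t' => F (s, t')) _ t :=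
    HasFDerivAt.comp t (hF.hasFDerivAt (s, t)) (hasFDerivAt_prodMk_right s t)
  simpa using h.hasDerivAt

lemma IsLegIsotopyJet.fderiv_radialExtension (hF : IsLegIsotopyJet m F)
    {σ : EuclideanSpace ℝ (Fin m)} (t : ℝ)
    {M : EuclideanSpace ℝ (Fin m) →L[ℝ] EuclideanSpace ℝ (Fin m)}
    (hM : HasFDerivAt (fun x => ‖x‖⁻¹ • x) M σ) (b : EuclideanSpace ℝ (Fin m) × ℝ) :
    fderiv ℝ (radialExtension F) (σ, t) b = fderiv ℝ F (‖σ‖⁻¹ • σ, t) (M b.1, b.2) := by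
  have h0 : HasFDerivAt (fun a : EuclideanSpace ℝ (Fin m) × ℝ => ‖a.1‖⁻¹ • a.1)
      (M.comp (ContinuousLinearMap.fst ℝ (EuclideanSpace ℝ (Fin m)) ℝ)) (σ, t) :=
    HasFDerivAt.comp (g := fun x => ‖x‖⁻¹ • x) (σ, t) hM
      (ContinuousLinearMap.fst ℝ (EuclideanSpace ℝ (Fin m)) ℝ).hasFDerivAt
  have h1 := h0.prodMk (ContinuousLinearMap.snd ℝ (EuclideanSpace ℝ (Fin m)) ℝ).hasFDerivAt
  have h : HasFDerivAt (radialExtension F) _ (σ, t) :=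
    HasFDerivAt.comp (σ, t) (hF.hasFDerivAt (‖σ‖⁻¹ • σ, t)) h1
  rw [h.fderiv]
  simp

lemma IsLegIsotopyJet.isRadialJetIsotopy (hF : IsLegIsotopyJet m F) (hnn : NonnegJet m F) :
    IsRadialJetIsotopy (radialExtension F) := by
  refine ⟨fun σ hσ t => ?_, fun c hc σ t => ?_,
    fun σ hσ t ht => mem_sphere_zero_iff_norm.1 (hF.mem_sphere _ (normalize_mem_sph hσ) t ht),
    fun σ hσ t ht => hF.mem_jet _ (normalize_mem_sph hσ) t ht, fun σ hσ t ht v => ?_,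
    fun σ hσ t ht v hv h => ?_, fun σ hσ t ht => ?_,
    fun t ht σ hσ τ hτ h => hF.inj t ht (normalize_mem_sph hσ) (normalize_mem_sph hτ) h⟩
  · have hn : ContDiffAt ℝ 3 (fun a : EuclideanSpace ℝ (Fin m) × ℝ => ‖a.1‖) (σ, t) :=
      contDiffAt_fst.norm ℝ hσ
    have h1 : ContDiffAt ℝ 3
        (fun a : EuclideanSpace ℝ (Fin m) × ℝ => (‖a.1‖⁻¹ • a.1, a.2)) (σ, t) :=
      ((hn.inv (norm_ne_zero_iff.2 hσ)).smul contDiffAt_fst).prodMk contDiffAt_snd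
    have h3 : ContDiff ℝ 3 F := contDiff_infty.1 hF.smooth 3
    exact h3.contDiffAt.comp (σ, t) h1
  · simp only [radialExtension, norm_smul, Real.norm_of_nonneg hc.le, smul_smul, mul_inv]
    rw [mul_right_comm, inv_mul_cancel₀ hc.ne', one_mul]
  · obtain ⟨M, hM, hM0, -⟩ := exists_hasFDerivAt_normalize hσ
    have h := hF.leg t ht _ (normalize_mem_sph hσ) (M v) (hM0 v)
    rwa [hF.fderiv_slice, ← hF.fderiv_radialExtension t hM (v, 0)] at h
  · obtain ⟨M, hM, hM0, hM1⟩ := exists_hasFDerivAt_normalize hσ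
    by_contra hne
    refine hF.imm t ht _ (normalize_mem_sph hσ) (M v) (hM0 v) ?_ ?_
    · rw [hM1 v hv]
      exact smul_ne_zero (inv_ne_zero (norm_ne_zero_iff.2 hσ)) hne
    · rw [hF.fderiv_slice, ← hF.fderiv_radialExtension t hM (v, 0), h]
  · obtain ⟨M, hM, -⟩ := exists_hasFDerivAt_normalize hσ
    have h := hnn _ (normalize_mem_sph hσ) t ht
    have hd := hF.hasDerivAt_time (‖σ‖⁻¹ • σ) t
    have h1 : HasDerivAt (fun t' => (F (‖σ‖⁻¹ • σ, t')).1) _ t := hasFDerivAt_fst.comp_hasDerivAt t hd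
    have h2 : HasDerivAt (fun t' => (F (‖σ‖⁻¹ • σ, t')).2.2) _ t :=
      hasFDerivAt_snd.comp_hasDerivAt t (hasFDerivAt_snd.comp_hasDerivAt t hd)
    rw [h1.deriv, h2.deriv] at h
    rw [hF.fderiv_radialExtension t hM (0, 1), map_zero]
    exact h

end Jet

theorem nonneg_isotopy_zero_section_to_jet_graph (m : ℕ) (hm : 2 ≤ m)
    (f : EuclideanSpace ℝ (Fin m) → ℝ) (hf : ContDiff ℝ (⊤ : ℕ∞) f)
    (F : EuclideanSpace ℝ (Fin m) × ℝ → JetSp m)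
    (hF : IsLegIsotopyJet m F) (hnn : NonnegJet m F)
    (hF0 : ∀ s ∈ sph m, F (s, 0) = (s, 0, 0))
    (hF1 : jetSlice m F 1 = jetGraph m f) :
    ∀ q ∈ sph m, 0 ≤ f q := by
  intro q hq
  refine le_of_forall_pos_le_add fun η hη => ?_
  have h0 : ∀ σ ≠ 0, radialExtension F (σ, 0) = (‖σ‖⁻¹ • σ, 0, 0) := fun σ hσ =>
    hF0 _ (normalize_mem_sph hσ)
  obtain ⟨s, hs, hs1, hs2⟩ := (hF.isRadialJetIsotopy hnn).exists_neg_le h0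
    (mem_sphere_zero_iff_norm.1 hq) hη
  simp only [radialExtension, hs, inv_one, one_smul] at hs1 hs2
  have hmem : F (s, 1) ∈ jetSlice m F 1 := mem_image_of_mem _ (mem_sphere_zero_iff_norm.2 hs)
  rw [hF1] at hmem
  obtain ⟨q', -, hq'⟩ := hmem
  simp only [← hq'] at hs1 hs2
  subst hs1
  linarith
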